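/- arXiv:1703.07429 — 3 statements merged into one kernel-verified Lean document; each statement's English description precedes it below -/
import Mathlib

section
/- Let L be a countable signature and let A be a countable L-structure. Then A has an ℵ₁-big elementary extension Â with |Â| ≤ 2^{ℵ₀}. -/
open FirstOrder Language Set Cardinal Topology

universe u v w

namespace Paper

/-- The topology of pointwise convergence on `X → X` (product topology, `X` discrete). -/
def ptTop (X : Type*) : TopologicalSpace (X → X) :=
  ⨅ x : X, TopologicalSpace.induced (fun f => f x) ⊥

/-- The topology of pointwise convergence on the symmetric group on `X`
(subspace topology inherited from `X → X`). -/
def symTop (X : Type*) : TopologicalSpace (Equiv.Perm X) :=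
  TopologicalSpace.induced (fun g : Equiv.Perm X => ⇑g) (ptTop X)

/-- The subspace topology (of the topology of pointwise convergence) on a
permutation group on `X`. -/
def subgroupTop {X : Type*} (H : Subgroup (Equiv.Perm X)) : TopologicalSpace H :=
  TopologicalSpace.induced (fun h : H => (⇑(h : Equiv.Perm X) : X → X)) (ptTop X)

/-- The subspace topology (of the topology of pointwise convergence) on a
transformation monoid on `X`. -/
def submonoidTop {X : Type*} (N : Submonoid (Function.End X)) : TopologicalSpace N :=
  TopologicalSpace.induced (fun n : N => ((n : Function.End X) : X → X)) (ptTop X)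

variable (L : FirstOrder.Language.{u, v}) (M : Type w) [L.Structure M]

/-- The monoid of self-embeddings of a structure, as a submonoid of `Function.End M`. -/
def embM : Submonoid (Function.End M) where
  carrier := {f | ∃ e : M ↪[L] M, ⇑e = f}
  one_mem' := ⟨Embedding.refl L M, rfl⟩
  mul_mem' := by
    rintro f g ⟨e₁, rfl⟩ ⟨e₂, rfl⟩
    exact ⟨e₁.comp e₂, rfl⟩

/-- The monoid of elementary self-embeddings of a structure, as a submonoid of
`Function.End M`. -/
def eembM : Submonoid (Function.End M) where
  carrier := {f | ∃ e : M ↪ₑ[L] M, ⇑e = f}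
  one_mem' := ⟨ElementaryEmbedding.refl L M, rfl⟩
  mul_mem' := by
    rintro f g ⟨e₁, rfl⟩ ⟨e₂, rfl⟩
    exact ⟨e₁.comp e₂, rfl⟩

/-- The automorphism group of a structure, as a subgroup of `Equiv.Perm M`. -/
def autG : Subgroup (Equiv.Perm M) where
  carrier := {g | ∃ e : M ≃[L] M, ⇑e = ⇑g}
  one_mem' := ⟨Language.Equiv.refl L M, rfl⟩
  mul_mem' := by
    rintro g h ⟨e₁, he₁⟩ ⟨e₂, he₂⟩
    exact ⟨e₁.comp e₂, funext fun x => by simp [he₁, he₂]⟩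
  inv_mem' := by
    rintro g ⟨e, he⟩
    refine ⟨e.symm, funext fun x => e.injective ?_⟩
    rw [Language.Equiv.apply_symm_apply, he]
    simp



variable (L : FirstOrder.Language.{u, v}) (M : Type w) [L.Structure M]

/-- `M` is `κ`-saturated: for every tuple `ā` over `M` of length `< κ`, every elementary
extension `N` of `M` and every `b ∈ N` there is `c ∈ M` with `(N, āb) ≡ (M, āc)`. -/
def IsSaturatedAt (κ : Cardinal.{w}) : Prop :=
  ∀ (α : Type w), #α < κ →
    ∀ (N : Type w) (_ : L.Structure N) (e : M ↪ₑ[L] N) (a : α → M) (b : N),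
      ∃ c : M, ∀ φ : L.Formula (α ⊕ Unit),
        φ.Realize (Sum.elim (⇑e ∘ a) fun _ => b) ↔ φ.Realize (Sum.elim a fun _ => c)

/-- `M` is saturated if it is `|M|`-saturated. -/
def IsSaturated : Prop := IsSaturatedAt L M #M

/-- A substructure `V` of `M` is superhomogeneous in `M` if (1) every local isomorphism of `V`
(an isomorphism between finitely generated substructures of `V`) extends to an automorphism
of `M` whose restriction to `V` is an automorphism of `V`, and (2) for every `y ∉ V` there is
an automorphism of `M` fixing `V` pointwise that moves `y`. -/
def IsSuperhomogeneous (V : L.Substructure M) : Prop :=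
  (∀ (S : L.Substructure M), S ≤ V → S.FG → ∀ f : S ↪[L] M, (∀ s : S, f s ∈ V) →
      ∃ g : M ≃[L] M, (∀ s : S, g s = f s) ∧ ⇑g '' (V : Set M) = (V : Set M)) ∧
  (∀ y : M, y ∉ V → ∃ g : M ≃[L] M, (∀ v ∈ V, g v = v) ∧ g y ≠ y)

/-- The theory of `M` has quantifier elimination: every formula is equivalent, modulo the
theory of `M`, to a quantifier-free formula. -/
def HasQE : Prop :=
  ∀ (n : ℕ) (φ : L.Formula (Fin n)), ∃ ψ : L.Formula (Fin n),
    ψ.IsQF ∧ (φ ⇔[L.completeTheory M] ψ)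

/-- A countable saturated structure is smooth if its signature is countable and its theory
has quantifier elimination. -/
def Smooth : Prop :=
  L.card ≤ ℵ₀ ∧ Countable M ∧ IsSaturated L M ∧ HasQE L M

/-- The center of the automorphism group of `M` is trivial. -/
def TrivialAutCenter : Prop :=
  ∀ e : M ≃[L] M, (∀ g : M ≃[L] M, ∀ x : M, e (g x) = g (e x)) → ∀ x : M, e x = x

/-- The language with a single relation symbol of arity `n`. -/
def oneRel (n : ℕ) : FirstOrder.Language :=
  ⟨fun _ => Empty, fun m => PLift (m = n)⟩

/-- The structure on `M` over `oneRel n` given by interpreting the relation symbol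
as `R ⊆ Mⁿ`. -/
def oneRelStructure {n : ℕ} {M : Type w} (R : Set (Fin n → M)) : (oneRel n).Structure M where
  funMap := fun f _ => f.elim
  RelMap := fun {m} r v => R (fun i => v (Fin.cast r.down.symm i))

/-- A structure `M` is splendid if for every extension of the language by a single relation
symbol `ρ` and every structure `N` for the extended language whose reduct is elementarily
equivalent to `M`, the symbol `ρ` can be interpreted in `M` in such a way that the resulting
expansion is elementarily equivalent to `N`. -/
def Splendid : Prop :=
  ∀ (n : ℕ) (N : Type w) (SN : L.Structure N) (RN : Set (Fin n → N)),
    (letI := SN; M ≅[L] N) →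
    ∃ RM : Set (Fin n → M),
      letI := SN
      letI : (oneRel n).Structure N := oneRelStructure RN
      letI : (oneRel n).Structure M := oneRelStructure RM
      M ≅[L.sum (oneRel n)] N

/-- A structure `M` is `κ`-big if all of its expansions by constants `(M, ā)`, for tuples `ā`
of length `< κ`, are splendid. -/
def IsBig (κ : Cardinal.{w}) : Prop :=
  ∀ (α : Type w), #α < κ → ∀ a : α → M,
    letI : (constantsOn α).Structure M := constantsOn.structure a
    Splendid (L[[α]]) M


universe w' w''

/-- A structure together with a family of its elements indexed by `X`. -/
structure Pointed (K : FirstOrder.Language.{u, v}) (X : Type*) where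
  /-- The underlying type. -/
  carrier : Type w
  /-- The structure. -/
  [str : K.Structure carrier]
  /-- The distinguished family. -/
  val : X → carrier

attribute [instance] Pointed.str

namespace Pointed

/-- Truth in a pointed structure of a formula with variables named by elements of `X`. -/
def Sat {K : FirstOrder.Language.{u, v}} {X Y : Type*} (p : Pointed.{u, v, w} K X)
    (φ : K.Formula Y) (s : Y → X) : Prop :=
  φ.Realize (p.val ∘ s)

/-- The reduct of a pointed structure along the left inclusion of languages. -/
def reduct {K : FirstOrder.Language.{u, v}} {K' : FirstOrder.Language.{0, 0}} {X : Type*}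
    (p : Pointed.{u, v, w} (K.sum K') X) : Pointed.{u, v, w} K X :=
  letI : K.Structure p.carrier := (LHom.sumInl : K →ᴸ K.sum K').reduct p.carrier
  ⟨p.carrier, p.val⟩

/-- Two pointed structures agree on `S` if the parts of their families indexed by `S` have the
same type. -/
def Agree {K : FirstOrder.Language.{u, v}} {X : Type*} (S : Set X) (p : Pointed.{u, v, w} K X)
    (q : Pointed.{u, v, w'} K X) : Prop :=
  ∀ (k : ℕ) (φ : K.Formula (Fin k)) (s : Fin k → X), (∀ i, s i ∈ S) → (p.Sat φ s ↔ q.Sat φ s)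

/-- The element `c` witnesses the existential quantification of `φ` at the parameters `s`. -/
def HenkinAt {K : FirstOrder.Language.{u, v}} {X : Type*} (p : Pointed.{u, v, w} K X)
    {m : ℕ} (φ : K.BoundedFormula Empty (m + 1)) (s : Fin m → X) (c : X) : Prop :=
  (∃ a, φ.Realize default (Fin.snoc (p.val ∘ s) a : Fin (m + 1) → p.carrier)) →
    φ.Realize default (Fin.snoc (p.val ∘ s) (p.val c) : Fin (m + 1) → p.carrier)

section

variable {K : FirstOrder.Language.{u, v}} {K' : FirstOrder.Language.{0, 0}} {X Y Z : Type*}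

theorem sat_relabel (p : Pointed.{u, v, w} K X) (φ : K.Formula Z) (g : Z → Y) (s : Y → X) :
    p.Sat (φ.relabel g) s ↔ p.Sat φ (s ∘ g) := by
  simp [Sat, Formula.realize_relabel, Function.comp_assoc]

theorem reduct_sat (p : Pointed.{u, v, w} (K.sum K') X) (φ : K.Formula Y) (s : Y → X) :
    p.reduct.Sat φ s ↔ p.Sat (LHom.sumInl.onFormula φ) s := by
  let : K.Structure p.carrier := (LHom.sumInl : K →ᴸ K.sum K').reduct p.carrier
  have : (LHom.sumInl : K →ᴸ K.sum K').IsExpansionOn p.carrier := ⟨fun _ _ => rfl, fun _ _ => rfl⟩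
  exact (LHom.realize_onFormula (M := p.carrier) (LHom.sumInl : K →ᴸ K.sum K') φ).symm

theorem sat_eq {p : Pointed.{u, v, w} K X} {x y : X} :
    p.Sat ((Term.var 0).equal (Term.var 1) : K.Formula (Fin 2)) ![x, y] ↔ p.val x = p.val y := by
  simp [Sat]

theorem agree_of_val_eq (p : Pointed.{u, v, w} K X) (x : X → p.carrier) {S : Set X}
    (h : ∀ c ∈ S, p.val c = x c) : p.Agree S ⟨p.carrier, x⟩ := by
  intro k φ s hs
  have : p.val ∘ s = x ∘ s := funext fun i => h _ (hs i)
  rw [Sat, Sat, this]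

theorem exists_henkin_formula {m : ℕ} (φ : K.BoundedFormula Empty (m + 1)) :
    ∃ ψ : K.Formula (Fin (m + 1)), ∀ (p : Pointed.{u, v, w} K X) (s : Fin m → X) (c : X),
      p.HenkinAt φ s c ↔ p.Sat ψ (Fin.snoc s c : Fin (m + 1) → X) := by
  refine ⟨(φ.ex.toFormula.relabel (Sum.elim Empty.elim Fin.castSucc)).imp
    (φ.toFormula.relabel (Sum.elim Empty.elim id)), fun p s c => ?_⟩
  have h1 : (p.val ∘ (Fin.snoc s c : Fin (m + 1) → X)) = Fin.snoc (p.val ∘ s) (p.val c) := by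
    funext i
    refine Fin.lastCases ?_ (fun j => ?_) i <;> simp
  have h2 : (Fin.snoc (p.val ∘ s) (p.val c) : Fin (m + 1) → p.carrier) ∘ Fin.castSucc =
      p.val ∘ s := by
    funext i
    simp
  rw [Sat, h1, Formula.realize_imp, Formula.realize_relabel, Formula.realize_relabel,
    BoundedFormula.realize_toFormula, BoundedFormula.realize_toFormula,
    BoundedFormula.realize_ex, HenkinAt, Function.comp_assoc, Function.comp_assoc,
    Function.comp_assoc, Function.comp_assoc, Sum.elim_comp_inr, Sum.elim_comp_inr, h2,
    Function.comp_id, Subsingleton.elim (_ ∘ _ ∘ Sum.inl) (default : Empty → p.carrier),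
    Subsingleton.elim (_ ∘ _ ∘ Sum.inl) (default : Empty → p.carrier)]

theorem Agree.sat {S : Set X} {p : Pointed.{u, v, w} K X} {q : Pointed.{u, v, w'} K X}
    (h : p.Agree S q) (φ : K.Formula Y) {s : Y → X} (hs : ∀ i, s i ∈ S) :
    p.Sat φ s ↔ q.Sat φ s := by
  classical
  let e := φ.freeVarFinset.equivFin
  have aux : ∀ {M : Type w} [K.Structure M] (x : Y → M), φ.Realize x ↔
      (Formula.Realize (M := M) (BoundedFormula.restrictFreeVar φ e)
        (x ∘ fun i => (e.symm i : Y))) :=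
    fun x => (BoundedFormula.realize_restrictFreeVar x (fun a => by simp)).symm
  have aux' : ∀ {M : Type w'} [K.Structure M] (x : Y → M), φ.Realize x ↔
      (Formula.Realize (M := M) (BoundedFormula.restrictFreeVar φ e)
        (x ∘ fun i => (e.symm i : Y))) :=
    fun x => (BoundedFormula.realize_restrictFreeVar x (fun a => by simp)).symm
  rw [Sat, Sat, aux, aux']
  exact h _ (BoundedFormula.restrictFreeVar φ e) (s ∘ fun i => (e.symm i : Y)) (fun i => hs _)

theorem Agree.refl (S : Set X) (p : Pointed.{u, v, w} K X) : p.Agree S p :=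
  fun _ _ _ _ => Iff.rfl

theorem Agree.symm {S : Set X} {p : Pointed.{u, v, w} K X} {q : Pointed.{u, v, w'} K X}
    (h : p.Agree S q) : q.Agree S p :=
  fun k φ s hs => (h k φ s hs).symm

theorem Agree.trans {S : Set X} {p : Pointed.{u, v, w} K X} {q : Pointed.{u, v, w'} K X}
    {r : Pointed.{u, v, w''} K X} (h : p.Agree S q) (h' : q.Agree S r) : p.Agree S r :=
  fun k φ s hs => (h k φ s hs).trans (h' k φ s hs)

theorem Agree.henkinAt {S : Set X} {p q : Pointed.{u, v, w} K X} (h : p.Agree S q) {m : ℕ}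
    (φ : K.BoundedFormula Empty (m + 1)) {s : Fin m → X} {c : X} (hs : ∀ i, s i ∈ S)
    (hc : c ∈ S) : p.HenkinAt φ s c ↔ q.HenkinAt φ s c := by
  obtain ⟨ψ, hψ⟩ := exists_henkin_formula (X := X) φ
  rw [hψ, hψ]
  exact h.sat ψ fun i => Fin.lastCases (by simpa using hc) (fun j => by simpa using hs j) i

theorem Agree.reduct {S : Set X} {p : Pointed.{u, v, w} (K.sum K') X}
    {q : Pointed.{u, v, w'} (K.sum K') X} (h : p.Agree S q) : p.reduct.Agree S q.reduct := by
  intro k φ s hs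
  rw [reduct_sat, reduct_sat]
  exact h k _ s hs

theorem Agree.mono {S S' : Set X} (hS : S ⊆ S') {p : Pointed.{u, v, w} K X}
    {q : Pointed.{u, v, w'} K X} (h : p.Agree S' q) : p.Agree S q :=
  fun k φ s hs => h k φ s fun i => hS (hs i)

end

/-- Compactness: if formulas hold eventually along a filter of pointed structures then they hold
simultaneously in a single one. -/
theorem exists_limit {K : FirstOrder.Language.{u, v}} {X : Type} [Nonempty X] {ι : Type*}
    (F : Filter ι) [F.NeBot] (p : ι → Pointed.{u, v, w} K X) :
    ∃ q : Pointed.{u, v, max u v} K X, ∀ {Y : Type} (φ : K.Formula Y) (s : Y → X),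
      (∀ᶠ i in F, (p i).Sat φ s) → q.Sat φ s := by
  classical
  let T : K[[X]].Theory := {σ | ∀ᶠ i in F, (p i).Sat (Formula.equivSentence.symm σ) id}
  have hT : T.IsSatisfiable := by
    rw [Theory.isSatisfiable_iff_isFinitelySatisfiable]
    intro T0 hT0
    have h1 : ∀ᶠ i in F, ∀ σ ∈ T0, (p i).Sat (Formula.equivSentence.symm σ) id :=
      (Filter.eventually_all_finset T0).2 fun σ hσ => hT0 hσ
    obtain ⟨i, hi⟩ := h1.exists
    let := constantsOn.structure (p i).val
    have : Nonempty (p i).carrier := ‹Nonempty X›.map (p i).val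
    have : (p i).carrier ⊨ (T0 : K[[X]].Theory) := by
      refine ⟨fun σ hσ => ?_⟩
      exact (Formula.realize_equivSentence_symm _ σ (p i).val).1 (hi σ hσ)
    exact Theory.Model.isSatisfiable (p i).carrier
  obtain ⟨M⟩ := hT
  let : K.Structure M := (K.lhomWithConstants X).reduct M
  have : (K.lhomWithConstants X).IsExpansionOn M := ⟨fun _ _ => rfl, fun _ _ => rfl⟩
  refine ⟨⟨M, fun x => (K.con x : M)⟩, fun φ s hφ => ?_⟩
  have h2 : Formula.equivSentence (φ.relabel s) ∈ T := by
    simpa [T, sat_relabel] using hφ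
  have h3 : M ⊨ Formula.equivSentence (φ.relabel s) := Theory.realize_sentence_of_mem T h2
  exact (sat_relabel _ φ s id).1 ((Formula.realize_equivSentence M (φ.relabel s)).1 h3)

section

variable {K : FirstOrder.Language.{u, v}} {K' : FirstOrder.Language.{0, 0}} {X Y : Type}

theorem exists_extension {p : Pointed.{u, v, w} K X} {q : Pointed.{u, v, w'} K Y}
    [Nonempty q.carrier] (g : Y → X) (h : ∀ φ : K.Formula Y, p.Sat φ g ↔ q.Sat φ id)
    (θ : K.Formula X) (hθ : p.Sat θ id) :
    ∃ x : X → q.carrier, x ∘ g = q.val ∧ θ.Realize x := by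
  classical
  let gg : θ.freeVarFinset → Y ⊕ θ.freeVarFinset := fun f =>
    if hf : ∃ y, g y = f then Sum.inl hf.choose else Sum.inr f
  let φ : K.Formula Y := Formula.iExs θ.freeVarFinset (θ.restrictFreeVar gg)
  have hφ : p.Sat φ g := by
    refine Formula.realize_iExs.2 ⟨fun f => p.val f, ?_⟩
    refine (BoundedFormula.realize_restrictFreeVar p.val fun a => ?_).2 hθ
    by_cases hf : ∃ y, g y = a
    · simp only [gg, dif_pos hf, Sum.elim_inl, Function.comp_apply]
      rw [hf.choose_spec]
    · simp [gg, dif_neg hf]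
  obtain ⟨i, hi⟩ := Formula.realize_iExs.1 ((h φ).1 hφ)
  let x : X → q.carrier := fun c => if hc : ∃ y, g y = c then q.val hc.choose else
    if hc' : c ∈ θ.freeVarFinset then i ⟨c, hc'⟩ else Classical.arbitrary _
  refine ⟨x, ?_, ?_⟩
  · funext y
    have hy : ∃ y', g y' = g y := ⟨y, rfl⟩
    simp only [x, Function.comp_apply, dif_pos hy]
    have := (h (((Term.var 0).equal (Term.var 1) : K.Formula (Fin 2)).relabel
      ![hy.choose, y])).1 (by
        rw [sat_relabel]
        simpa [Sat] using congrArg p.val hy.choose_spec)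
    rw [sat_relabel] at this
    simpa [Sat] using this
  · refine (BoundedFormula.realize_restrictFreeVar x fun a => ?_).1 hi
    by_cases hf : ∃ y, g y = a
    · simp [gg, x, dif_pos hf]
    · simp [gg, x, dif_neg hf]

/-- Amalgamation of a structure with an expansion of a structure over a common part. -/
theorem exists_amalgam [Nonempty X] (p : Pointed.{u, v, w} K X)
    (q : Pointed.{u, v, w'} (K.sum K') Y) [Nonempty q.carrier] (g : Y → X)
    (h : ∀ φ : K.Formula Y, p.Sat φ g ↔ q.reduct.Sat φ id) :
    ∃ r : Pointed.{u, v, max u v} (K.sum K') X, p.Agree univ r.reduct ∧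
      ∀ ψ : (K.sum K').Formula Y, q.Sat ψ id ↔ r.Sat ψ g := by
  classical
  have : Nonempty q.reduct.carrier := ‹Nonempty q.carrier›
  have key : ∀ Θ : Finset (K.Formula X), ∃ x : X → q.carrier, x ∘ g = q.val ∧
      ∀ θ ∈ Θ, p.Sat θ id → Pointed.Sat (reduct (K' := K') ⟨q.carrier, x⟩) θ id := by
    intro Θ
    obtain ⟨x, hx, hx'⟩ := exists_extension (q := q.reduct) g h
      (Formula.iInf fun θ : {θ // θ ∈ Θ.filter fun θ => p.Sat θ id} => θ.1) (by
        refine Formula.realize_iInf.2 ?_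
        rintro ⟨θ, hθ⟩
        exact (Finset.mem_filter.1 hθ).2)
    refine ⟨x, hx, fun θ hθ hθ' => ?_⟩
    exact (Formula.realize_iInf.1 hx') ⟨θ, Finset.mem_filter.2 ⟨hθ, hθ'⟩⟩
  choose x hx hx' using key
  obtain ⟨r, hr⟩ := exists_limit (Filter.atTop) fun Θ => (⟨q.carrier, x Θ⟩ : Pointed (K.sum K') X)
  have h1 : ∀ θ : K.Formula X, p.Sat θ id → r.reduct.Sat θ id := by
    intro θ hθ
    rw [reduct_sat]
    refine hr _ _ ((Filter.eventually_ge_atTop {θ}).mono fun Θ hΘ => ?_)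
    rw [← reduct_sat]
    exact hx' Θ θ (hΘ (Finset.mem_singleton_self θ)) hθ
  have h2 : ∀ ψ : (K.sum K').Formula Y, q.Sat ψ id → r.Sat ψ g := by
    intro ψ hψ
    refine hr _ _ (Filter.Eventually.of_forall fun Θ => ?_)
    change ψ.Realize (x Θ ∘ g)
    rw [hx]
    exact hψ
  refine ⟨r, fun k φ s _ => ?_, fun ψ => ⟨h2 ψ, fun hψ => ?_⟩⟩
  · have := h1 (φ.relabel s)
    have h' := h1 (φ.not.relabel s)
    rw [sat_relabel, sat_relabel] at this h'
    exact ⟨this, fun hφ => by_contra fun hn => h' hn hφ⟩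
  · by_contra hn
    exact h2 ψ.not hn hψ

end

end Pointed

/-- An enumeration of a type, surjective if the type is countable. -/
noncomputable def enum (β : Type*) [Nonempty β] : ℕ → β :=
  Classical.epsilon Function.Surjective

theorem enum_surjective (β : Type*) [Nonempty β] [Countable β] : (enum β).Surjective :=
  Classical.epsilon_spec (exists_surjective_nat β)

/-- Names for the elements of the structure under construction: the elements of `A`, and Henkin
witnesses for expansions by an `n`-ary relation. -/
inductive Name (A : Type) : Type
  /-- The name of an element of `A`. -/
  | base : A → Name A
  /-- The name of a Henkin witness. -/
  | wit (n : ℕ) (I T : Set ℕ) (k : ℕ) (tup : I → Name A) (s : ℕ → Name A) : Name A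

/-- The datum of a complete theory (coded by `T`) of an expansion by an `n`-ary relation and by
constants for the tuple `tup`. -/
structure Task (A : Type) where
  /-- The arity of the relation. -/
  n : ℕ
  /-- The index set of the tuple. -/
  I : Set ℕ
  /-- The code of the theory. -/
  T : Set ℕ
  /-- The tuple. -/
  tup : I → Name A

namespace Task

variable {A : Type}

/-- The name of the Henkin witness for the `k`-th formula with parameters `s`. -/
def wit (t : Task A) (k : ℕ) (s : ℕ → Name A) : Name A :=
  Name.wit t.n t.I t.T k t.tup s

theorem wit_inj {t t' : Task A} {k k' : ℕ} {s s' : ℕ → Name A} (h : t.wit k s = t'.wit k' s') :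
    t = t' ∧ k = k' ∧ s = s' := by
  obtain ⟨n, I, T, tup⟩ := t
  obtain ⟨n', I', T', tup'⟩ := t'
  simp only [wit, Name.wit.injEq] at h
  obtain ⟨rfl, rfl, rfl, rfl, h, rfl⟩ := h
  cases h
  exact ⟨rfl, rfl, rfl⟩

end Task

/-- A set of names is closed if it contains all names of elements of `A` and all names occurring
in its members. -/
def NameClosed {A : Type} (S : Set (Name A)) : Prop :=
  (∀ a, Name.base a ∈ S) ∧
    ∀ (t : Task A) (k : ℕ) (s : ℕ → Name A), t.wit k s ∈ S → (∀ i, t.tup i ∈ S) ∧ ∀ i, s i ∈ S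

/-- The enumeration of the formulas with free variables in `I`. -/
noncomputable def formulaAt (L : FirstOrder.Language.{u, v}) (n : ℕ) (I : Set ℕ) :
    ℕ → (L.sum (oneRel n)).Formula I :=
  enum _

/-- The enumeration of the formulas that need Henkin witnesses. -/
noncomputable def henkinAt (L : FirstOrder.Language.{u, v}) (n : ℕ) :
    ℕ → Σ m : ℕ, (L.sum (oneRel n)).BoundedFormula Empty (m + 1) :=
  enum _

section

variable {L : FirstOrder.Language.{u, v}} {A : Type}

/-- The theory coded by the task is consistent with the type of its tuple. -/
def Task.Valid (t : Task A) (P : Pointed.{u, v, w} L (Name A)) : Prop :=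
  ∃ q : Pointed.{u, v, 0} (L.sum (oneRel t.n)) t.I, Nonempty q.carrier ∧
    (∀ k ∈ t.T, q.Sat (formulaAt L t.n t.I k) id) ∧
      ∀ φ : L.Formula t.I, P.Sat φ t.tup ↔ q.reduct.Sat φ id

/-- The pointed structure `q` solves the task over `S`: it expands the type of `S` in `P`, is a
model of the theory coded by the task, and the witnesses in `S` are Henkin witnesses. -/
def Task.Solves (t : Task A) (S : Set (Name A)) (P : Pointed.{u, v, w} L (Name A))
    (q : Pointed.{u, v, w'} (L.sum (oneRel t.n)) (Name A)) : Prop :=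
  (∀ k ∈ t.T, q.Sat (formulaAt L t.n t.I k) t.tup) ∧ P.Agree S q.reduct ∧
    ∀ k s, t.wit k s ∈ S → q.HenkinAt (henkinAt L t.n k).2 (fun i => s i) (t.wit k s)

theorem Task.Valid.congr {t : Task A} {P : Pointed.{u, v, w} L (Name A)}
    {P' : Pointed.{u, v, w'} L (Name A)} {S : Set (Name A)} (hv : t.Valid P)
    (h : P.Agree S P') (ht : ∀ i, t.tup i ∈ S) : t.Valid P' := by
  obtain ⟨q, hq, hT, hφ⟩ := hv
  exact ⟨q, hq, hT, fun φ => (h.sat φ ht).symm.trans (hφ φ)⟩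

theorem Task.Valid.exists_solves [Nonempty A] {t : Task A} {P : Pointed.{u, v, w} L (Name A)}
    {S : Set (Name A)} (hv : t.Valid P) (hS : ∀ k s, t.wit k s ∉ S) :
    ∃ q : Pointed.{u, v, max u v} (L.sum (oneRel t.n)) (Name A), t.Solves S P q := by
  obtain ⟨q, hq, hT, hφ⟩ := hv
  have : Nonempty (Name A) := ‹Nonempty A›.map Name.base
  obtain ⟨r, hr, hr'⟩ := Pointed.exists_amalgam P q t.tup hφ
  exact ⟨r, fun k hk => (hr' _).1 (hT k hk), hr.mono (subset_univ S),
    fun k s h => absurd h (hS k s)⟩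

open Classical in
theorem Task.Solves.exists_insert {t : Task A} {S : Set (Name A)}
    {P : Pointed.{u, v, w} L (Name A)}
    {q : Pointed.{u, v, w'} (L.sum (oneRel t.n)) (Name A)} (hq : t.Solves S P q)
    (hS : NameClosed S) {k : ℕ} {s : ℕ → Name A} (hc : t.wit k s ∉ S) (ht : ∀ i, t.tup i ∈ S)
    (hs : ∀ i, s i ∈ S) :
    ∃ q' : Pointed.{u, v, w'} (L.sum (oneRel t.n)) (Name A), q.Agree S q' ∧
      t.Solves (insert (t.wit k s) S) q'.reduct q' := by
  have : Nonempty q.carrier := ⟨q.val (t.wit k s)⟩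
  let R : q.carrier → Prop := fun b => (henkinAt L t.n k).2.Realize default
    (Fin.snoc (q.val ∘ fun i : Fin (henkinAt L t.n k).1 => s i) b :
      Fin ((henkinAt L t.n k).1 + 1) → q.carrier)
  obtain ⟨a, ha⟩ : ∃ a, (∃ b, R b) → R a := by
    by_cases h : ∃ b, R b
    · exact h.imp fun a ha _ => ha
    · exact ⟨Classical.arbitrary _, fun h' => absurd h' h⟩
  have hval : ∀ c ∈ S, q.val c = Function.update q.val (t.wit k s) a c := fun c hcS =>
    (Function.update_of_ne (ne_of_mem_of_not_mem hcS hc) _ _).symm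
  have hag := q.agree_of_val_eq _ hval
  refine ⟨⟨q.carrier, Function.update q.val (t.wit k s) a⟩, hag,
    fun l hl => (hag.sat _ ht).1 (hq.1 l hl), Pointed.Agree.refl _ _, fun l s' hl => ?_⟩
  by_cases hls : t.wit l s' ∈ S
  · exact (hag.henkinAt _ (fun i => (hS.2 t l s' hls).2 _) hls).1 (hq.2.2 l s' hls)
  · obtain ⟨-, rfl, rfl⟩ := Task.wit_inj (hl.resolve_right hls)
    have h1 : (Function.update q.val (t.wit l s') a ∘ fun i : Fin (henkinAt L t.n l).1 => s' i) =
        q.val ∘ fun i : Fin (henkinAt L t.n l).1 => s' i := funext fun i => (hval _ (hs i)).symm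
    intro h2
    simp only [h1] at h2 ⊢
    rw [Function.update_self]
    exact ha h2

variable (L A) in
/-- An approximation to the structure under construction, restricted to a closed set of names. -/
structure Stage [L.Structure A] where
  /-- The set of names. -/
  S : Set (Name A)
  closed : NameClosed S
  /-- A structure with elements named by `S` (the other names are irrelevant). -/
  P : Pointed.{u, v, max u v} L (Name A)
  elementary : ∀ φ : L.Formula A, φ.Realize id ↔ P.Sat φ Name.base
  good : ∀ t : Task A, (∀ i, t.tup i ∈ S) → t.Valid P →
    ∃ q : Pointed.{u, v, max u v} (L.sum (oneRel t.n)) (Name A), t.Solves S P q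

variable [L.Structure A]

instance : Preorder (Stage L A) where
  le σ τ := σ.S ⊆ τ.S ∧ σ.P.Agree σ.S τ.P
  le_refl σ := ⟨subset_rfl, Pointed.Agree.refl _ _⟩
  le_trans _ _ _ h h' := ⟨h.1.trans h'.1, h.2.trans (h'.2.mono h.1)⟩

theorem nonempty_stage [Nonempty A] : Nonempty (Stage L A) := by
  classical
  have : Nonempty (Name A) := ‹Nonempty A›.map Name.base
  let p : Pointed L (Name A) := ⟨A, fun x => match x with
    | Name.base a => a
    | _ => Classical.arbitrary A⟩
  obtain ⟨P, hP⟩ := Pointed.exists_limit (Filter.atTop : Filter Unit) fun _ => p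
  have hp : ∀ φ : L.Formula A, p.Sat φ Name.base ↔ φ.Realize id := fun φ => Iff.rfl
  have hb : ∀ t : Task A, ∀ k s, t.wit k s ∉ range Name.base := by
    rintro t k s ⟨a, ha⟩
    cases ha
  refine ⟨range Name.base, ⟨mem_range_self, fun t k s h => absurd h (hb t k s)⟩, P, fun φ => ?_,
    fun t _ hv => hv.exists_solves (hb t)⟩
  refine ⟨fun h => hP φ _ (Filter.Eventually.of_forall fun _ => h), fun h => by_contra fun hn => ?_⟩
  exact hP φ.not Name.base (Filter.Eventually.of_forall fun _ => hn) h

theorem bddAbove_stage [Nonempty A] {c : Set (Stage L A)} (hc : IsChain (· ≤ ·) c)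
    (hne : c.Nonempty) : BddAbove c := by
  have : Nonempty (Name A) := ‹Nonempty A›.map Name.base
  have : Nonempty c := hne.to_subtype
  have : IsDirectedOrder c := directedOn_iff_isDirectedOrder.1 hc.directedOn
  obtain ⟨P, hP⟩ := Pointed.exists_limit (Filter.atTop : Filter c) fun i => i.1.P
  have hagree : ∀ i : c, i.1.P.Agree i.1.S P := by
    refine fun i k φ s hs => ⟨fun h => hP φ s ?_, fun h => by_contra fun hn => hP φ.not s ?_ h⟩
    · exact (Filter.eventually_ge_atTop i).mono fun j hj => (hj.2 k φ s hs).1 h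
    · exact (Filter.eventually_ge_atTop i).mono fun j hj h' => hn ((hj.2 k φ s hs).2 h')
  have hfin : ∀ {k : ℕ} (s : Fin k → Name A), (∀ i, s i ∈ ⋃ j : c, j.1.S) →
      ∃ j : c, ∀ i, s i ∈ j.1.S := by
    intro k s hs
    choose j hj using fun i => mem_iUnion.1 (hs i)
    obtain ⟨l, hl⟩ := Finite.exists_le j
    exact ⟨l, fun i => (hl i).1 (hj i)⟩
  refine ⟨⟨⋃ j : c, j.1.S, ⟨fun a => ?_, fun t k s h => ?_⟩, P, fun φ => ?_, fun t ht hv => ?_⟩,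
    fun i hi => ⟨subset_iUnion (fun j : c => j.1.S) ⟨i, hi⟩, hagree ⟨i, hi⟩⟩⟩
  · exact mem_iUnion.2 ⟨Classical.arbitrary c, (Classical.arbitrary c).1.closed.1 a⟩
  · obtain ⟨j, hj⟩ := mem_iUnion.1 h
    have := j.1.closed.2 t k s hj
    exact ⟨fun i => mem_iUnion.2 ⟨j, this.1 i⟩, fun i => mem_iUnion.2 ⟨j, this.2 i⟩⟩
  · let i := Classical.arbitrary c
    exact (i.1.elementary φ).trans ((hagree i).sat φ i.1.closed.1)
  · by_cases hi : ∃ i : c, ∀ x, t.tup x ∈ i.1.S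
    · obtain ⟨i, hi⟩ := hi
      have hsol : ∀ j : c, i ≤ j → ∃ q : Pointed.{u, v, max u v} (L.sum (oneRel t.n)) (Name A),
          t.Solves j.1.S j.1.P q := fun j hj =>
        have hj' : ∀ x, t.tup x ∈ j.1.S := fun x => hj.1 (hi x)
        j.1.good t hj' (hv.congr (hagree j).symm hj')
      have hsol' : ∀ j : c, ∃ q : Pointed.{u, v, max u v} (L.sum (oneRel t.n)) (Name A),
          i ≤ j → t.Solves j.1.S j.1.P q := by
        intro j
        by_cases hj : i ≤ j
        · exact (hsol j hj).imp fun q hq _ => hq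
        · exact (hsol i le_rfl).imp fun q _ hj' => absurd hj' hj
      choose q hq using hsol'
      obtain ⟨r, hr⟩ := Pointed.exists_limit (Filter.atTop : Filter c) q
      refine ⟨r, fun k hk => ?_, fun k φ s hs => ?_, fun k s hs => ?_⟩
      · exact hr _ _ ((Filter.eventually_ge_atTop i).mono fun j hj => (hq j hj).1 k hk)
      · obtain ⟨l, hl⟩ := hfin s hs
        have hj : ∀ᶠ j : c in Filter.atTop, P.Sat φ s ↔ (q j).reduct.Sat φ s := by
          filter_upwards [Filter.eventually_ge_atTop i, Filter.eventually_ge_atTop l] with j hj hj'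
          have hs' : ∀ x, s x ∈ j.1.S := fun x => hj'.1 (hl x)
          exact ((hagree j) k φ s hs').symm.trans ((hq j hj).2.1 k φ s hs')
        simp_rw [Pointed.reduct_sat] at hj
        rw [Pointed.reduct_sat]
        refine ⟨fun h => hr _ _ (hj.mono fun j hj => hj.1 h), fun h => by_contra fun hn => ?_⟩
        exact hr (LHom.sumInl.onFormula φ).not _ (hj.mono fun j hj h' => hn (hj.2 h')) h
      · obtain ⟨l, hl⟩ := mem_iUnion.1 hs
        obtain ⟨ψ, hψ⟩ := Pointed.exists_henkin_formula (X := Name A) (henkinAt L t.n k).2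
        rw [hψ]
        refine hr _ _ ?_
        filter_upwards [Filter.eventually_ge_atTop i, Filter.eventually_ge_atTop l] with j hj hj'
        rw [← hψ]
        exact (hq j hj).2.2 k s (hj'.1 hl)
    · refine hv.exists_solves fun k s h => hi ?_
      obtain ⟨j, hj⟩ := mem_iUnion.1 h
      exact ⟨j, (j.1.closed.2 t k s hj).1⟩

theorem Stage.exists_insert [Nonempty A] (σ : Stage L A) {t : Task A} {k : ℕ} {s : ℕ → Name A}
    (ht : ∀ i, t.tup i ∈ σ.S) (hs : ∀ i, s i ∈ σ.S) : ∃ τ : Stage L A, σ ≤ τ ∧ t.wit k s ∈ τ.S := by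
  classical
  have : Nonempty (Name A) := ‹Nonempty A›.map Name.base
  by_cases hc : t.wit k s ∈ σ.S
  · exact ⟨σ, le_rfl, hc⟩
  obtain ⟨P, hP, hsol⟩ : ∃ P : Pointed.{u, v, max u v} L (Name A), σ.P.Agree σ.S P ∧
      (t.Valid P → ∃ q : Pointed.{u, v, max u v} (L.sum (oneRel t.n)) (Name A),
        t.Solves (insert (t.wit k s) σ.S) P q) := by
    by_cases hv : t.Valid σ.P
    · obtain ⟨q, hq⟩ := σ.good t ht hv
      obtain ⟨q', hq', hsol⟩ := hq.exists_insert σ.closed hc ht hs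
      exact ⟨q'.reduct, hq.2.1.trans hq'.reduct, fun _ => ⟨q', hsol⟩⟩
    · exact ⟨σ.P, Pointed.Agree.refl _ _, fun h => absurd h hv⟩
  refine ⟨⟨insert (t.wit k s) σ.S, ⟨fun a => Or.inr (σ.closed.1 a), fun t' l s' h => ?_⟩, P,
    fun φ => (σ.elementary φ).trans (hP.sat φ σ.closed.1), fun t' ht' hv => ?_⟩,
    ⟨subset_insert _ _, hP⟩, mem_insert _ _⟩
  · by_cases hls : t'.wit l s' ∈ σ.S
    · have := σ.closed.2 t' l s' hls
      exact ⟨fun i => Or.inr (this.1 i), fun i => Or.inr (this.2 i)⟩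
    · obtain ⟨rfl, rfl, rfl⟩ := Task.wit_inj (h.resolve_right hls)
      exact ⟨fun i => Or.inr (ht i), fun i => Or.inr (hs i)⟩
  · by_cases htt : t' = t
    · subst htt
      exact hsol hv
    have hmem : ∀ l s', t'.wit l s' ∈ insert (t.wit k s) σ.S → t'.wit l s' ∈ σ.S := fun l s' h =>
      h.resolve_left fun h' => htt (Task.wit_inj h').1
    by_cases hS : ∀ i, t'.tup i ∈ σ.S
    · obtain ⟨q, hq⟩ := σ.good t' hS (hv.congr hP.symm hS)
      have : Nonempty q.carrier := ‹Nonempty (Name A)›.map q.val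
      obtain ⟨r, hr, hr'⟩ := Pointed.exists_amalgam P
        (⟨q.carrier, fun x : σ.S => q.val x⟩ : Pointed (L.sum (oneRel t'.n)) σ.S) Subtype.val
        fun φ => ((hP.symm.trans hq.2.1).sat φ fun i => i.2)
      have hqr : q.Agree σ.S r := by
        intro j φ x hx
        have := hr' (φ.relabel fun i => ⟨x i, hx i⟩)
        rw [Pointed.sat_relabel, Pointed.sat_relabel] at this
        exact this
      refine ⟨r, fun l hl => (hqr.sat _ hS).1 (hq.1 l hl), hr.mono (subset_univ _),
        fun l s' h => ?_⟩
      have h' := hmem l s' h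
      exact (hqr.henkinAt _ (fun i => (σ.closed.2 t' l s' h').2 _) h').1 (hq.2.2 l s' h')
    · exact hv.exists_solves fun l s' h => hS (σ.closed.2 t' l s' (hmem l s' h)).1

/-- There is a structure with elements named by `Name A` in which every valid task is solved. -/
theorem exists_solving [Nonempty A] : ∃ P : Pointed.{u, v, max u v} L (Name A),
    (∀ φ : L.Formula A, φ.Realize id ↔ P.Sat φ Name.base) ∧
      ∀ t : Task A, t.Valid P →
        ∃ q : Pointed.{u, v, max u v} (L.sum (oneRel t.n)) (Name A), t.Solves univ P q := by
  have : Nonempty (Stage L A) := nonempty_stage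
  obtain ⟨σ, hσ⟩ := zorn_le_nonempty (α := Stage L A) fun c hc hne => bddAbove_stage hc hne
  have hS : ∀ x, x ∈ σ.S := by
    intro x
    induction x with
    | base a => exact σ.closed.1 a
    | wit n I T k tup s ih1 ih2 =>
      obtain ⟨τ, hτ, h⟩ := σ.exists_insert (t := ⟨n, I, T, tup⟩) (k := k) ih1 ih2
      exact (hσ hτ).1 h
  refine ⟨σ.P, σ.elementary, fun t hv => ?_⟩
  rw [← eq_univ_of_forall hS]
  exact σ.good t (fun i => hS _) hv

end

theorem structure_eq_of_realize {L : FirstOrder.Language.{u, v}} {M : Type w}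
    {S S' : L.Structure M}
    (h : ∀ (k : ℕ) (φ : L.Formula (Fin k)) (x : Fin k → M),
      @Formula.Realize L M S _ φ x ↔ @Formula.Realize L M S' _ φ x) : S = S' := by
  ext n f x
  · have h1 := h _ (Formula.graph f) (Fin.cons (@Structure.funMap L M S n f x) x)
    rw [@Formula.realize_graph L M S, @Formula.realize_graph L M S'] at h1
    exact (h1.1 rfl).symm
  · have h1 := h _ (f.formula Term.var) x
    rw [@Formula.realize_rel L M S, @Formula.realize_rel L M S'] at h1
    exact h1

/-- If existential formulas have named witnesses, then the named elements form an elementary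
substructure, which can be transported along any parametrization `f` of the named elements. -/
theorem Pointed.exists_structure {K : FirstOrder.Language.{u, v}} {X N : Type}
    (q : Pointed.{u, v, w} K X)
    (hq : ∀ (m : ℕ) (φ : K.BoundedFormula Empty (m + 1)) (s : Fin m → X), ∃ c, q.HenkinAt φ s c)
    {f : X → N} (hf : f.Surjective) (hfq : ∀ x y, f x = f y ↔ q.val x = q.val y) :
    ∃ _ : K.Structure N, ∀ {Y : Type} (φ : K.Formula Y) (s : Y → X),
      φ.Realize (f ∘ s) ↔ q.Sat φ s := by
  have hlift : ∀ {n : ℕ} (x : Fin n → q.carrier), (∀ i, x i ∈ range q.val) →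
      ∃ s : Fin n → X, x = q.val ∘ s := by
    intro n x hx
    choose s hs using hx
    exact ⟨s, funext fun i => (hs i).symm⟩
  let E : K.Substructure q.carrier :=
    { carrier := range q.val
      fun_mem := by
        intro n g x hx
        obtain ⟨s, rfl⟩ := hlift x hx
        obtain ⟨c, hc⟩ := hq n (((Term.func g fun i => Term.var (Sum.inr i.castSucc)) :
          K.Term (Empty ⊕ Fin (n + 1))).bdEqual (Term.var (Sum.inr (Fin.last n)))) s
        refine ⟨c, ?_⟩
        simp only [HenkinAt, BoundedFormula.realize_bdEqual, Term.realize_func,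
          Term.realize_var, Sum.elim_inr, Fin.snoc_castSucc, Fin.snoc_last] at hc
        exact (hc ⟨_, rfl⟩).symm }
  have hE : E.IsElementary := by
    refine E.isElementary_of_exists fun n φ x a ha => ?_
    obtain ⟨s, hs⟩ := hlift (fun i => (x i : q.carrier)) fun i => (x i).2
    obtain ⟨c, hc⟩ := hq n φ s
    refine ⟨⟨q.val c, c, rfl⟩, ?_⟩
    have hs' : ((↑) ∘ x : Fin n → q.carrier) = q.val ∘ s := hs
    rw [hs'] at ha ⊢
    exact hc ⟨a, ha⟩
  let g : N → E := fun b => ⟨q.val (Function.surjInv hf b), _, rfl⟩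
  have hgf : ∀ x, (g (f x) : q.carrier) = q.val x := fun x =>
    (hfq _ _).1 (Function.surjInv_eq hf (f x))
  have hg : g.Bijective := by
    refine ⟨fun b b' h => ?_, ?_⟩
    · rw [← Function.surjInv_eq hf b, ← Function.surjInv_eq hf b']
      exact (hfq _ _).2 (congrArg Subtype.val h)
    · rintro ⟨_, x, rfl⟩
      exact ⟨f x, Subtype.ext (hgf x)⟩
  let e : E ≃ N := (_root_.Equiv.ofBijective g hg).symm
  let : K.Structure N := e.inducedStructure
  let E' : K.ElementarySubstructure q.carrier := ⟨E, hE⟩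
  let e' : N ≃[K] E := (e.inducedStructureEquiv (L := K)).symm
  refine ⟨e.inducedStructure, fun φ s => ?_⟩
  rw [← StrongHomClass.realize_formula e' φ]
  refine (ElementarySubstructure.subtype E').map_formula φ _ |>.symm.trans ?_
  have : (ElementarySubstructure.subtype E' ∘ e' ∘ f ∘ s) = q.val ∘ s :=
    funext fun i => hgf (s i)
  rw [this, Sat]

theorem countable_symbols_sum_oneRel {L : FirstOrder.Language.{u, v}} (hL : L.card ≤ ℵ₀) (n : ℕ) :
    Countable (L.sum (oneRel n)).Symbols := by
  have : Countable L.Symbols := mk_le_aleph0_iff.1 hL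
  have h1 : Countable (Σ l, L.Relations l) := Function.Injective.countable
    (Sum.inr_injective : Function.Injective (Sum.inr : _ → L.Symbols))
  have h2 : ∀ l, Countable (L.Functions l) := fun l =>
    (sigma_mk_injective (i := l) (β := L.Functions)).countable
  have h3 : ∀ l, Countable (L.Relations l) := fun l =>
    (sigma_mk_injective (i := l) (β := L.Relations)).countable
  have h4 : ∀ l, Countable ((L.sum (oneRel n)).Functions l) := fun l =>
    inferInstanceAs (Countable (L.Functions l ⊕ Empty))
  have h5 : ∀ l, Countable ((L.sum (oneRel n)).Relations l) := fun l =>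
    inferInstanceAs (Countable (L.Relations l ⊕ PLift (l = n)))
  exact inferInstanceAs (Countable ((Σ l, (L.sum (oneRel n)).Functions l) ⊕
    Σ l, (L.sum (oneRel n)).Relations l))

theorem formulaAt_surjective {L : FirstOrder.Language.{u, v}} (hL : L.card ≤ ℵ₀) (n : ℕ)
    (I : Set ℕ) : (formulaAt L n I).Surjective := by
  have := countable_symbols_sum_oneRel hL n
  exact enum_surjective _

theorem henkinAt_surjective {L : FirstOrder.Language.{u, v}} (hL : L.card ≤ ℵ₀) (n : ℕ) :
    (henkinAt L n).Surjective := by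
  have := countable_symbols_sum_oneRel hL n
  have : Countable (Σ m : ℕ, (L.sum (oneRel n)).BoundedFormula Empty (m + 1)) :=
    Function.Injective.countable
      (f := fun φ => (⟨φ.1 + 1, φ.2⟩ : Σ m, (L.sum (oneRel n)).BoundedFormula Empty m)) (by
        rintro ⟨m, φ⟩ ⟨m', φ'⟩ h
        simp only [Sigma.mk.injEq, Nat.add_right_cancel_iff] at h
        obtain ⟨rfl, h⟩ := h
        rw [eq_of_heq h])
  exact enum_surjective _

theorem Task.Solves.exists_structure {L : FirstOrder.Language.{u, v}} {A N : Type} [Nonempty A]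
    (hL : L.card ≤ ℵ₀) {t : Task A} {P : Pointed.{u, v, w} L (Name A)}
    {q : Pointed.{u, v, w'} (L.sum (oneRel t.n)) (Name A)} (hq : t.Solves univ P q)
    {f : Name A → N} (hf : f.Surjective) (hfP : ∀ x y, f x = f y ↔ P.val x = P.val y) :
    ∃ _ : (L.sum (oneRel t.n)).Structure N, ∀ {Y : Type} (φ : (L.sum (oneRel t.n)).Formula Y)
      (s : Y → Name A), φ.Realize (f ∘ s) ↔ q.Sat φ s := by
  have : Nonempty (Name A) := ‹Nonempty A›.map Name.base
  refine q.exists_structure (fun m φ s => ?_) hf fun x y => ?_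
  · obtain ⟨k, hk⟩ := henkinAt_surjective hL t.n ⟨m, φ⟩
    let s' : ℕ → Name A := fun i => if h : i < m then s ⟨i, h⟩ else Classical.arbitrary _
    have hs' : (fun i : Fin m => s' i) = s := funext fun i => by simp [s']
    refine ⟨t.wit k s', ?_⟩
    have := hq.2.2 k s' (mem_univ _)
    rw [hk] at this
    rwa [← hs']
  · exact (hfP x y).trans <| Pointed.sat_eq.symm.trans <|
      (hq.2.1 _ _ _ fun i => mem_univ _).trans (Pointed.sat_eq (p := q.reduct))

/-- The structure given by `S` on a sum of languages is the expansion of its left reduct by a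
relation. -/
theorem exists_oneRelStructure_eq {L : FirstOrder.Language.{u, v}} {n : ℕ} {M : Type w}
    (S : (L.sum (oneRel n)).Structure M) :
    ∃ R : Set (Fin n → M), S =
      @Language.sumStructure L (oneRel n) M (@LHom.reduct _ _ LHom.sumInl M S)
        (oneRelStructure R) := by
  refine ⟨{x | S.RelMap (Sum.inr ⟨rfl⟩ : (L.sum (oneRel n)).Relations n) x}, ?_⟩
  ext m g x
  · rcases g with g | g
    · rfl
    · exact g.elim
  · rcases g with g | g
    · rfl
    · obtain ⟨h⟩ : PLift (m = n) := g
      subst h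
      rfl

/-- Every structure for a language with constants is the expansion of a structure by constants. -/
theorem exists_withConstants_eq {L : FirstOrder.Language.{u, v}} {α M : Type}
    (S : L[[α]].Structure M) : ∃ (S₀ : L.Structure M) (a : α → M),
      S = @Language.withConstantsStructure L M S₀ α (constantsOn.structure a) := by
  refine ⟨@LHom.reduct _ _ (L.lhomWithConstants α) M S, fun c => (L.con c : M), ?_⟩
  ext m g x
  · rcases g with g | g
    · rfl
    · match m, g with
      | 0, c =>
        rw [Subsingleton.elim x default]
        rfl
  · rcases g with g | g
    · rfl
    · exact g.elim

/-- Sentences in the expansion by constants and a relation are formulas of the expansion by a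
relation evaluated at the constants. -/
theorem exists_formula_of_sentence {L : FirstOrder.Language.{u, v}} {n : ℕ} {α : Type}
    (σ : (L[[α]].sum (oneRel n)).Sentence) :
    ∃ φ : (L.sum (oneRel n)).Formula α, ∀ {M : Type} [L.Structure M] (a : α → M)
      (R : Set (Fin n → M)),
      letI := constantsOn.structure a
      letI : (oneRel n).Structure M := oneRelStructure R
      M ⊨ σ ↔ φ.Realize a := by
  let H : L[[α]].sum (oneRel n) →ᴸ (L.sum (oneRel n))[[α]] :=
    LHom.sumElim (LHom.sumElim (LHom.sumInl.comp LHom.sumInl) LHom.sumInr)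
      (LHom.sumInl.comp LHom.sumInr)
  refine ⟨Formula.equivSentence.symm (H.onSentence σ), fun {M} _ a R => ?_⟩
  let := constantsOn.structure a
  let : (oneRel n).Structure M := oneRelStructure R
  rw [Formula.realize_equivSentence_symm]
  have : H.IsExpansionOn M := by
    constructor
    · rintro m ((g | g) | g) x <;> rfl
    · rintro m ((g | g) | g) x <;> rfl
  exact (H.realize_onSentence M σ).symm

theorem mk_name_le {A : Type} [Countable A] : #(Name A) ≤ 2 ^ ℵ₀ := by
  let α := A ⊕ ℕ × Set ℕ × Set ℕ × ℕ
  let β : α → Type := Sum.elim (fun _ => Empty) fun x => x.2.1 ⊕ ℕ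
  let g : WType β → Name A := WType.elim (Name A) fun x => match x with
    | ⟨Sum.inl a, _⟩ => Name.base a
    | ⟨Sum.inr (n, I, T, k), h⟩ =>
      Name.wit n I T k (fun i => h (Sum.inl i)) fun i => h (Sum.inr i)
  have hg : g.Surjective := by
    intro x
    induction x with
    | base a => exact ⟨WType.mk (Sum.inl a) Empty.elim, rfl⟩
    | wit n I T k tup s ih1 ih2 =>
      choose x hx using ih1
      choose y hy using ih2
      refine ⟨WType.mk (Sum.inr (n, I, T, k)) (Sum.elim x y), ?_⟩
      simp only [g, WType.elim, Sum.elim_inl, Sum.elim_inr]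
      exact congrArg₂ _ (funext hx) (funext hy)
  have hβ : ∀ a, #(β a) ≤ ℵ₀ := by
    rintro (a | a)
    · exact mk_le_aleph0_iff.2 (inferInstanceAs (Countable Empty))
    · exact mk_le_aleph0_iff.2 (inferInstanceAs (Countable (a.2.1 ⊕ ℕ)))
  have hα : #α ≤ 2 ^ ℵ₀ := by
    have hA : #A ≤ 𝔠 := (mk_le_aleph0_iff.2 ‹_›).trans aleph0_le_continuum
    simp only [α, mk_sum, mk_prod, mk_set, mk_nat, lift_id, two_power_aleph0]
    simpa using add_le_of_le aleph0_le_continuum hA le_rfl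
  have hpow : ∀ a, ((2 : Cardinal.{0}) ^ ℵ₀) ^ #(β a) ≤ 2 ^ ℵ₀ := by
    intro a
    refine (power_le_power_left (by simp [continuum_ne_zero]) (hβ a)).trans ?_
    rw [← power_mul, aleph0_mul_aleph0]
  refine (mk_le_of_surjective hg).trans (WType.cardinalMk_le_of_le ?_)
  refine (Cardinal.sum_le_sum _ _ hpow).trans ?_
  rw [sum_const']
  refine (mul_le_mul_left hα _).trans ?_
  rw [two_power_aleph0, continuum_mul_self]

section

variable {L : FirstOrder.Language.{u, v}} {A : Type}

theorem exists_structure_of_elementary [Nonempty A] [L.Structure A] (hL : L.card ≤ ℵ₀)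
    {P : Pointed.{u, v, max u v} L (Name A)}
    (hP : ∀ φ : L.Formula A, φ.Realize id ↔ P.Sat φ Name.base)
    (hsol : ∀ t : Task A, t.Valid P →
        ∃ q : Pointed.{u, v, max u v} (L.sum (oneRel t.n)) (Name A), t.Solves univ P q)
    {N : Type} {f : Name A → N} (hf : f.Surjective)
    (hfP : ∀ x y, f x = f y ↔ P.val x = P.val y) :
    ∃ _ : L.Structure N, ∀ {Y : Type} (φ : L.Formula Y) (s : Y → Name A),
      φ.Realize (f ∘ s) ↔ P.Sat φ s := by
  let t : Task A := ⟨0, ∅, ∅, fun i => i.2.elim⟩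
  have hv : t.Valid P := by
    let : (oneRel 0).Structure A := oneRelStructure ∅
    let q : Pointed (L.sum (oneRel 0)) (∅ : Set ℕ) := ⟨A, fun i => i.2.elim⟩
    refine ⟨q, ‹Nonempty A›, fun k hk => hk.elim, fun φ => ?_⟩
    rw [Pointed.reduct_sat]
    have h1 : q.Sat (LHom.sumInl.onFormula φ) id ↔
        φ.Realize ((fun i => i.2.elim) : (∅ : Set ℕ) → A) := LHom.realize_onFormula _ φ
    have h2 := hP (φ.relabel fun i => i.2.elim)
    rw [Pointed.sat_relabel, Formula.realize_relabel] at h2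
    rw [h1]
    convert h2.symm using 2 <;> exact Subsingleton.elim _ _
  obtain ⟨q, hq⟩ := hsol t hv
  obtain ⟨S, hS⟩ := hq.exists_structure hL hf hfP
  let : L.Structure N := LHom.sumInl.reduct (L' := L.sum (oneRel t.n)) N
  refine ⟨LHom.sumInl.reduct (L' := L.sum (oneRel t.n)) N, fun φ s => ?_⟩
  have : (LHom.sumInl : L →ᴸ L.sum (oneRel t.n)).IsExpansionOn N :=
    ⟨fun _ _ => rfl, fun _ _ => rfl⟩
  rw [hq.2.1.sat φ fun i => mem_univ _, Pointed.reduct_sat, ← hS]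
  exact (LHom.realize_onFormula _ φ).symm

theorem Task.Solves.exists_oneRelStructure [Nonempty A] (hL : L.card ≤ ℵ₀) {t : Task A}
    {P : Pointed.{u, v, w} L (Name A)}
    {q : Pointed.{u, v, w'} (L.sum (oneRel t.n)) (Name A)} (hq : t.Solves univ P q)
    {N : Type} {f : Name A → N} (hf : f.Surjective)
    (hfP : ∀ x y, f x = f y ↔ P.val x = P.val y) [SN : L.Structure N]
    (hN : ∀ {Y : Type} (φ : L.Formula Y) (s : Y → Name A), φ.Realize (f ∘ s) ↔ P.Sat φ s) :
    ∃ R : Set (Fin t.n → N),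
      letI : (oneRel t.n).Structure N := oneRelStructure R
      ∀ {Y : Type} (φ : (L.sum (oneRel t.n)).Formula Y) (s : Y → Name A),
        φ.Realize (f ∘ s) ↔ q.Sat φ s := by
  obtain ⟨S, hS⟩ := hq.exists_structure hL hf hfP
  obtain ⟨R, hR⟩ := exists_oneRelStructure_eq S
  have hSN : LHom.sumInl.reduct (L' := L.sum (oneRel t.n)) N = SN := by
    refine structure_eq_of_realize fun k φ x => ?_
    obtain ⟨s, rfl⟩ : ∃ s, x = f ∘ s :=
      ⟨Function.surjInv hf ∘ x, funext fun i => (Function.surjInv_eq hf _).symm⟩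
    rw [hN, hq.2.1.sat φ fun i => mem_univ _, Pointed.reduct_sat, ← hS]
    let : L.Structure N := LHom.sumInl.reduct (L' := L.sum (oneRel t.n)) N
    have : (LHom.sumInl : L →ᴸ L.sum (oneRel t.n)).IsExpansionOn N :=
      ⟨fun _ _ => rfl, fun _ _ => rfl⟩
    exact (LHom.realize_onFormula _ φ).symm
  rw [hSN] at hR
  subst hR
  exact ⟨R, hS⟩

theorem isBig_of_solves [Nonempty A] (hL : L.card ≤ ℵ₀)
    {P : Pointed.{u, v, max u v} L (Name A)}
    (hsol : ∀ t : Task A, t.Valid P →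
        ∃ q : Pointed.{u, v, max u v} (L.sum (oneRel t.n)) (Name A), t.Solves univ P q)
    {N : Type} {f : Name A → N} (hf : f.Surjective)
    (hfP : ∀ x y, f x = f y ↔ P.val x = P.val y) [L.Structure N]
    (hN : ∀ {Y : Type} (φ : L.Formula Y) (s : Y → Name A), φ.Realize (f ∘ s) ↔ P.Sat φ s) :
    IsBig L N (Cardinal.aleph 1) := by
  intro α hα a n M SM RM hM
  obtain ⟨SM, b, rfl⟩ := exists_withConstants_eq SM
  have : Nonempty N := ‹Nonempty A›.map fun a => f (Name.base a)
  have : Countable α := by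
    rwa [← Cardinal.succ_aleph0, Order.lt_succ_iff, mk_le_aleph0_iff] at hα
  obtain ⟨j, hj⟩ := exists_injective_nat α
  let e : α ≃ range j := _root_.Equiv.ofInjective j hj
  let : (constantsOn α).Structure N := constantsOn.structure a
  let : (constantsOn α).Structure M := constantsOn.structure b
  let : (oneRel n).Structure M := oneRelStructure RM
  let q : Pointed (L.sum (oneRel n)) (range j) := ⟨M, b ∘ e.symm⟩
  let t : Task A := ⟨n, range j, {k | q.Sat (formulaAt L n (range j) k) id},
    Function.surjInv hf ∘ a ∘ e.symm⟩
  have hft : f ∘ t.tup = a ∘ e.symm := funext fun i => Function.surjInv_eq hf _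
  have hv : t.Valid P := by
    refine ⟨q, ?_, fun k hk => hk, fun φ => ?_⟩
    · exact ElementarilyEquivalent.nonempty hM
    · rw [← hN, hft, Pointed.reduct_sat]
      have h1 : q.Sat (LHom.sumInl.onFormula φ) id ↔ φ.Realize (b ∘ e.symm) :=
        LHom.realize_onFormula _ φ
      rw [h1, ← Formula.realize_relabel, ← Formula.realize_relabel]
      let ψ := Formula.equivSentence (φ.relabel e.symm)
      have h2 : φ.relabel e.symm = Formula.equivSentence.symm ψ := by simp [ψ]
      rw [h2, Formula.realize_equivSentence_symm, Formula.realize_equivSentence_symm]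
      exact elementarilyEquivalent_iff.1 hM ψ
  obtain ⟨r, hr⟩ := hsol t hv
  obtain ⟨R, hR⟩ := hr.exists_oneRelStructure hL hf hfP hN
  let : (oneRel n).Structure N := oneRelStructure R
  refine ⟨R, elementarilyEquivalent_iff.2 fun σ => ?_⟩
  obtain ⟨φ, hφ⟩ := exists_formula_of_sentence σ
  refine (hφ a R).trans (Iff.trans ?_ (hφ b RM).symm)
  have key : ∀ φ : (L.sum (oneRel n)).Formula (range j), q.Sat φ id → r.Sat φ t.tup := by
    intro φ h
    obtain ⟨k, rfl⟩ := formulaAt_surjective hL n (range j) φ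
    exact hr.1 k h
  have key' : q.Sat (φ.relabel e) id ↔ r.Sat (φ.relabel e) t.tup :=
    ⟨key _, fun h => by_contra fun hn => key (φ.relabel e).not hn h⟩
  rw [Pointed.sat_relabel, Pointed.sat_relabel, ← hR] at key'
  have h1 : f ∘ t.tup ∘ e = a := by
    rw [← Function.comp_assoc, hft, Function.comp_assoc, e.symm_comp_self, Function.comp_id]
  have h2 : q.val ∘ id ∘ e = b := by
    rw [Function.id_comp, Function.comp_assoc, e.symm_comp_self, Function.comp_id]
  rw [h1, Pointed.Sat, h2] at key'
  exact key'.symm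

theorem isBig_of_isEmpty [IsEmpty A] [L.Structure A] (κ : Cardinal.{0}) : IsBig L A κ := by
  intro α _ a n M SM RM hM
  let := constantsOn.structure a
  have : IsEmpty M := by
    rw [← not_nonempty_iff, ← hM.nonempty_iff, not_nonempty_iff]
    infer_instance
  refine ⟨{_x | RM.Nonempty}, ?_⟩
  let : (oneRel n).Structure M := oneRelStructure RM
  let R : Set (Fin n → A) := {_x | RM.Nonempty}
  let : (oneRel n).Structure A := oneRelStructure R
  let e : A ≃[L[[α]].sum (oneRel n)] M :=
    { toEquiv := _root_.Equiv.equivOfIsEmpty A M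
      map_fun' := fun g x => isEmptyElim (Structure.funMap g x)
      map_rel' := by
        rintro m (r | r) x
        · obtain rfl : m = 0 := by
            by_contra hm
            exact isEmptyElim (x ⟨0, Nat.pos_of_ne_zero hm⟩)
          have h1 := elementarilyEquivalent_iff.1 hM (r.formula isEmptyElim)
          rw [Sentence.Realize, Formula.realize_rel, Sentence.Realize, Formula.realize_rel] at h1
          rw [relMap_sumInl, relMap_sumInl]
          convert h1.symm using 2
        · change (fun i => _) ∈ RM ↔ RM.Nonempty
          refine ⟨fun h => ⟨_, h⟩, fun ⟨y, hy⟩ => ?_⟩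
          convert hy }
  exact StrongHomClass.elementarilyEquivalent e

end

/-- Every countable structure over a countable signature has an ℵ₁-big
elementary extension of cardinality at most `2 ^ ℵ₀`. -/
theorem statement_14 (L : FirstOrder.Language.{u, v}) (hL : L.card ≤ ℵ₀)
    (A : Type) [L.Structure A] [Countable A] :
    ∃ (N : Type) (SN : L.Structure N),
      letI := SN
      Nonempty (A ↪ₑ[L] N) ∧ IsBig L N (Cardinal.aleph 1) ∧ #N ≤ 2 ^ ℵ₀ := by
  cases isEmpty_or_nonempty A
  · exact ⟨A, inferInstance, ⟨ElementaryEmbedding.refl L A⟩, isBig_of_isEmpty _,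
      by simp⟩
  obtain ⟨P, hP, hsol⟩ := exists_solving (L := L) (A := A)
  let N := Quotient (Setoid.ker P.val)
  let f : Name A → N := Quotient.mk _
  have hf : f.Surjective := Quotient.mk_surjective
  have hfP : ∀ x y, f x = f y ↔ P.val x = P.val y := fun x y => Quotient.eq
  obtain ⟨SN, hN⟩ := exists_structure_of_elementary hL hP hsol hf hfP
  refine ⟨N, SN, ⟨⟨f ∘ Name.base, fun n φ x => ?_⟩⟩, isBig_of_solves hL hsol hf hfP hN,
    (mk_le_of_surjective hf).trans mk_name_le⟩
  have h := hP (φ.relabel x)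
  rw [Formula.realize_relabel, Pointed.sat_relabel, ← hN] at h
  exact h.symm

end Paper
end

section
/- Let U be a countable saturated structure and, for some sufficiently large uncountable cardinal λ, let Û be a λ-big elementary extension of U. Then for every u ∈ Û ∖ U there exists an automorphism α of Û that fixes U pointwise and satisfies α(u) ≠ u. -/
open FirstOrder Language Set Cardinal Topology

universe u v w

namespace Paper

variable (L : FirstOrder.Language.{u, v}) (M : Type w) [L.Structure M]

variable (L : FirstOrder.Language.{u, v}) (M : Type w) [L.Structure M]

section IteratedUltrafilter

open Filter Function

variable {X : Type*}

/-- The ultrafilter on `ℤ → X` obtained by choosing the coordinates `a, …, a + n - 1` successively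
along `D` and keeping all other coordinates of `x`. -/
def iterUltrafilter (D : Ultrafilter X) (x : ℤ → X) (a : ℤ) : ℕ → Ultrafilter (ℤ → X)
  | 0 => pure x
  | n + 1 => D.bind fun y => iterUltrafilter D (update x a y) (a + 1) n

variable (D : Ultrafilter X)

theorem mem_iterUltrafilter_zero {x : ℤ → X} {a : ℤ} {s : Set (ℤ → X)} :
    s ∈ iterUltrafilter D x a 0 ↔ x ∈ s := Iff.rfl

theorem mem_iterUltrafilter_succ {x : ℤ → X} {a : ℤ} {n : ℕ} {s : Set (ℤ → X)} :
    s ∈ iterUltrafilter D x a (n + 1) ↔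
      ∀ᶠ y in D, s ∈ iterUltrafilter D (update x a y) (a + 1) n := Iff.rfl

theorem mem_iterUltrafilter_congr {s : Set (ℤ → X)} {T : Set ℤ} (hs : DependsOn (· ∈ s) T)
    {n : ℕ} {a : ℤ} {x y : ℤ → X} (h : ∀ i ∈ T, i ∉ Ico a (a + n) → x i = y i) :
    s ∈ iterUltrafilter D x a n ↔ s ∈ iterUltrafilter D y a n := by
  induction n generalizing a x y with
  | zero => exact (hs fun i hi => h i hi (by simp)).to_iff
  | succ n ih =>
    simp only [mem_iterUltrafilter_succ]
    refine eventually_congr (.of_forall fun z => ih fun i hi hia => ?_)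
    obtain rfl | hne := eq_or_ne i a
    · simp
    · rw [update_of_ne hne, update_of_ne hne]
      refine h i hi fun hw => hia ?_
      simp only [mem_Ico] at hw ⊢
      push_cast at hw
      omega

theorem mem_iterUltrafilter_succ_left {s : Set (ℤ → X)} {T : Set ℤ} (hs : DependsOn (· ∈ s) T)
    {n : ℕ} {a : ℤ} (ha : a ∉ T) (x : ℤ → X) :
    s ∈ iterUltrafilter D x a (n + 1) ↔ s ∈ iterUltrafilter D x (a + 1) n := by
  rw [mem_iterUltrafilter_succ]
  have h : ∀ y, s ∈ iterUltrafilter D (update x a y) (a + 1) n ↔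
      s ∈ iterUltrafilter D x (a + 1) n := fun y =>
    mem_iterUltrafilter_congr D hs fun i hi _ => update_of_ne (by rintro rfl; exact ha hi) _ _
  simp only [h, eventually_const]

theorem mem_iterUltrafilter_succ_right {s : Set (ℤ → X)} {T : Set ℤ} (hs : DependsOn (· ∈ s) T)
    {n : ℕ} {a : ℤ} (ha : a + n ∉ T) (x : ℤ → X) :
    s ∈ iterUltrafilter D x a (n + 1) ↔ s ∈ iterUltrafilter D x a n := by
  induction n generalizing a x with
  | zero =>
    rw [mem_iterUltrafilter_succ_left D hs (by simpa using ha)]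
    rfl
  | succ n ih =>
    rw [mem_iterUltrafilter_succ, mem_iterUltrafilter_succ]
    refine eventually_congr (.of_forall fun z => ih ?_ _)
    rwa [add_assoc, add_comm 1 (n : ℤ), ← Nat.cast_succ]

/-- The shift of bi-infinite sequences. -/
def shift (x : ℤ → X) : ℤ → X := fun i => x (i + 1)

theorem preimage_shift_mem_iterUltrafilter {s : Set (ℤ → X)} {n : ℕ} {a : ℤ} {x : ℤ → X} :
    shift ⁻¹' s ∈ iterUltrafilter D x (a + 1) n ↔ s ∈ iterUltrafilter D (shift x) a n := by
  induction n generalizing a x with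
  | zero => rfl
  | succ n ih =>
    simp only [mem_iterUltrafilter_succ, ih]
    refine eventually_congr (.of_forall fun y => ?_)
    have h : shift (update x (a + 1) y) = update (shift x) a y := by
      ext i
      simp [shift, update_apply]
    rw [h]

theorem mem_iterUltrafilter_of_eventually {s : Set (ℤ → X)} {j : ℤ}
    (hs : DependsOn (· ∈ s) (Iic j)) (h : ∀ x : ℤ → X, ∀ᶠ y in D, update x j y ∈ s)
    {n : ℕ} {a : ℤ} (hj : j ∈ Ico a (a + n)) (x : ℤ → X) :
    s ∈ iterUltrafilter D x a n := by
  induction n generalizing a x with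
  | zero => simp at hj
  | succ n ih =>
    rw [mem_iterUltrafilter_succ]
    obtain rfl | hne := eq_or_ne j a
    · filter_upwards [h x] with y hy
      have hconst : ∀ (n : ℕ) (a : ℤ) (z : ℤ → X), j < a →
          (s ∈ iterUltrafilter D z a n ↔ z ∈ s) := by
        intro n
        induction n with
        | zero => exact fun _ _ _ => Iff.rfl
        | succ n ih =>
          intro a z ha
          rw [mem_iterUltrafilter_succ_left D hs (by simpa using ha)]
          exact ih _ _ (by omega)
      exact (hconst n _ _ (by omega)).2 hy
    · refine .of_forall fun y => ih ?_ _
      simp only [mem_Ico] at hj ⊢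
      push_cast at hj
      omega

/-- An ultrafilter on `ℤ → X` which restricts, on the sets that depend on finitely many
coordinates, to the `ℤ`-fold iterate of `D`. -/
noncomputable def zUltrafilter (x₀ : X) : Ultrafilter (ℤ → X) :=
  (hyperfilter ℕ).bind fun n => iterUltrafilter D (fun _ => x₀) (-n) (2 * n)

variable (x₀ : X)

theorem mem_zUltrafilter {s : Set (ℤ → X)} :
    s ∈ zUltrafilter D x₀ ↔
      ∀ᶠ n : ℕ in hyperfilter ℕ, s ∈ iterUltrafilter D (fun _ => x₀) (-n) (2 * n) := Iff.rfl

theorem preimage_shift_mem_zUltrafilter {s : Set (ℤ → X)} {T : Set ℤ} (hT : T.Finite)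
    (hs : DependsOn (· ∈ s) T) :
    shift ⁻¹' s ∈ zUltrafilter D x₀ ↔ s ∈ zUltrafilter D x₀ := by
  rw [mem_zUltrafilter, mem_zUltrafilter]
  have h1 : ∀ᶠ n : ℕ in hyperfilter ℕ, (-n - 1 : ℤ) ∉ T := by
    refine Nat.hyperfilter_le_atTop ?_
    rw [← Nat.cofinite_eq_atTop]
    exact (hT.preimage (f := fun n : ℕ => (-n - 1 : ℤ)) fun _ _ _ _ h => by
      simpa using h).compl_mem_cofinite
  have h2 : ∀ᶠ n : ℕ in hyperfilter ℕ, (n - 1 : ℤ) ∉ T := by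
    refine Nat.hyperfilter_le_atTop ?_
    rw [← Nat.cofinite_eq_atTop]
    exact (hT.preimage (f := fun n : ℕ => (n - 1 : ℤ)) fun _ _ _ _ h => by
      simpa using h).compl_mem_cofinite
  have h3 : ∀ᶠ n : ℕ in hyperfilter ℕ, 1 ≤ n := Nat.hyperfilter_le_atTop (eventually_ge_atTop 1)
  refine eventually_congr ?_
  filter_upwards [h1, h2, h3] with n hn1 hn2 hn3
  obtain ⟨k, hk⟩ : ∃ k, 2 * n = k + 1 := ⟨2 * n - 1, by omega⟩
  have e1 : (-n : ℤ) = (-n - 1) + 1 := by ring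
  have e2 : (-n - 1 + 1 : ℤ) + k = n - 1 := by omega
  rw [hk, e1, preimage_shift_mem_iterUltrafilter, mem_iterUltrafilter_succ_left D hs hn1,
    mem_iterUltrafilter_succ_right D hs (by rwa [e2])]
  rfl

theorem mem_zUltrafilter_of_eventually {s : Set (ℤ → X)} {j : ℤ}
    (hs : DependsOn (· ∈ s) (Iic j)) (h : ∀ x : ℤ → X, ∀ᶠ y in D, update x j y ∈ s) :
    s ∈ zUltrafilter D x₀ := by
  rw [mem_zUltrafilter]
  filter_upwards [Nat.hyperfilter_le_atTop (eventually_gt_atTop j.natAbs)] with n hn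
  exact mem_iterUltrafilter_of_eventually D hs h (by simp only [mem_Ico]; push_cast; omega) _

end IteratedUltrafilter

section Transfer

open Structure

variable {L L' : FirstOrder.Language} {M N : Type*}

theorem forall_realize_iff_of_elementarilyEquivalent [L.Structure M] [L.Structure N]
    (h : M ≅[L] N) {γ : Type*} [Finite γ] (φ : L.Formula γ) :
    (∀ v : γ → M, φ.Realize v) ↔ ∀ v : γ → N, φ.Realize v := by
  have key := elementarilyEquivalent_iff.1 h
    ((φ.relabel (Sum.inr : γ → Empty ⊕ γ)).iAlls γ)
  simpa [Sentence.Realize, Formula.realize_iAlls, Function.comp_def] using key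

/-- If a binary relation symbol of a larger language is interpreted in `N` by a total and
surjective relation preserving all `L`-formulas, then in every elementarily equivalent
structure it is interpreted by the graph of an automorphism of the `L`-reduct. -/
theorem exists_equiv_of_relMap [L.Structure M] [L.Structure N] [L'.Structure M] [L'.Structure N]
    (φ : L →ᴸ L') [φ.IsExpansionOn M] [φ.IsExpansionOn N] (h : M ≅[L'] N) (ρ : L'.Relations 2)
    (hl : ∀ x : N, ∃ y, RelMap ρ ![x, y]) (hr : ∀ y : N, ∃ x, RelMap ρ ![x, y])
    (hψ : ∀ (n : ℕ) (ψ : L.Formula (Fin n)) (x y : Fin n → N),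
      (∀ i, RelMap ρ ![x i, y i]) → (ψ.Realize x ↔ ψ.Realize y)) :
    ∃ g : M ≃[L] M, ∀ x y, RelMap ρ ![x, y] ↔ g x = y := by
  have hl' : ∀ x : M, ∃ y, RelMap ρ ![x, y] := by
    have key := forall_realize_iff_of_elementarilyEquivalent h
      ((ρ.formula₂ (Term.var (Sum.inl ())) (Term.var (Sum.inr ())) :
        L'.Formula (Unit ⊕ Unit)).iExs Unit)
    simp only [Formula.realize_iExs, Formula.realize_rel₂, Term.realize_var, Sum.elim_inl,
      Sum.elim_inr] at key
    intro x
    obtain ⟨y, hy⟩ := key.2 (fun v => (hl (v ())).imp' (fun y _ => y) fun _ h => h) fun _ => x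
    exact ⟨_, hy⟩
  have hr' : ∀ y : M, ∃ x, RelMap ρ ![x, y] := by
    have key := forall_realize_iff_of_elementarilyEquivalent h
      ((ρ.formula₂ (Term.var (Sum.inr ())) (Term.var (Sum.inl ())) :
        L'.Formula (Unit ⊕ Unit)).iExs Unit)
    simp only [Formula.realize_iExs, Formula.realize_rel₂, Term.realize_var, Sum.elim_inl,
      Sum.elim_inr] at key
    intro x
    obtain ⟨y, hy⟩ := key.2 (fun v => (hr (v ())).imp' (fun y _ => y) fun _ h => h) fun _ => x
    exact ⟨_, hy⟩
  have hψ' : ∀ (n : ℕ) (ψ : L.Formula (Fin n)) (x y : Fin n → M),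
      (∀ i, RelMap ρ ![x i, y i]) → (ψ.Realize x ↔ ψ.Realize y) := by
    intro n ψ x y hxy
    have key := forall_realize_iff_of_elementarilyEquivalent h
      ((Formula.iInf fun i : Fin n =>
        (ρ.formula₂ (Term.var (Sum.inl i)) (Term.var (Sum.inr i)) :
          L'.Formula (Fin n ⊕ Fin n))).imp
        (((φ.onFormula ψ).relabel Sum.inl).iff ((φ.onFormula ψ).relabel Sum.inr)))
    simp only [Formula.realize_imp, Formula.realize_iInf, Formula.realize_rel₂, Term.realize_var,
      Formula.realize_iff, Formula.realize_relabel, LHom.realize_onFormula] at key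
    exact key.2 (fun v hv => hψ n ψ _ _ hv) (Sum.elim x y) hxy
  choose g hg using hl'
  have hinj : ∀ x y x' y' : M, RelMap ρ ![x, x'] → RelMap ρ ![y, y'] → (x = y ↔ x' = y') := by
    intro x y x' y' hx hy
    have key := hψ' 2 ((Term.var 0).equal (Term.var 1)) ![x, y] ![x', y']
      (by simp [Fin.forall_fin_two, hx, hy])
    simpa using key
  have hgiff : ∀ x y, RelMap ρ ![x, y] ↔ g x = y := fun x y =>
    ⟨fun hxy => (hinj _ _ _ _ (hg x) hxy).1 rfl, by rintro rfl; exact hg x⟩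
  have hbij : Function.Bijective g :=
    ⟨fun x y hxy => (hinj _ _ _ _ (hg x) (hg y)).2 hxy,
      fun y => (hr' y).imp fun x hx => (hgiff x y).1 hx⟩
  refine ⟨⟨Equiv.ofBijective g hbij, ?_, ?_⟩, hgiff⟩
  · intro n f x
    have key := hψ' (n + 1)
      ((Term.func f fun i => Term.var i.castSucc).equal (Term.var (Fin.last n)))
      (Fin.snoc x (funMap f x)) (g ∘ Fin.snoc x (funMap f x)) fun i => hg _
    simpa [eq_comm, Function.comp_def] using key
  · intro n r x
    have key := hψ' n (r.formula fun i => Term.var i) x (g ∘ x) fun i => hg _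
    simpa [Function.comp_def] using key.symm

end Transfer

section IteratedUltrapower

open Filter Structure

/-- The function `f` depends on finitely many coordinates only. -/
def DependsOnFinite {X β : Type*} (f : (ℤ → X) → β) : Prop :=
  ∃ T : Set ℤ, T.Finite ∧ DependsOn f T

namespace DependsOnFinite

variable {X β γ : Type*}

theorem const (b : β) : DependsOnFinite fun _ : ℤ → X => b :=
  ⟨∅, Set.finite_empty, fun _ _ _ => rfl⟩

theorem apply (i : ℤ) : DependsOnFinite fun z : ℤ → X => z i :=
  ⟨{i}, Set.finite_singleton i, fun _ _ h => h i rfl⟩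

theorem comp {f : (ℤ → X) → β} (hf : DependsOnFinite f) (g : β → γ) :
    DependsOnFinite fun z => g (f z) := by
  obtain ⟨T, hT, hf⟩ := hf
  exact ⟨T, hT, fun x y h => congrArg g (hf h)⟩

theorem pi {ι : Type*} [Finite ι] {f : ι → (ℤ → X) → β} (hf : ∀ i, DependsOnFinite (f i)) :
    DependsOnFinite fun z i => f i z := by
  choose T hT hf using hf
  exact ⟨⋃ i, T i, Set.finite_iUnion hT, fun x y h =>
    funext fun i => hf i fun k hk => h k (Set.mem_iUnion.2 ⟨i, hk⟩)⟩

theorem comp_add {f : (ℤ → X) → β} (hf : DependsOnFinite f) (k : ℤ) :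
    DependsOnFinite fun z => f fun i => z (i + k) := by
  obtain ⟨T, hT, hf⟩ := hf
  exact ⟨(· + k) '' T, hT.image _, fun x y h => hf fun i hi => h _ ⟨i, hi, rfl⟩⟩

theorem eventually_shift {p : (ℤ → X) → Prop} (hp : DependsOnFinite p) (D : Ultrafilter X)
    (x₀ : X) :
    (∀ᶠ z in zUltrafilter D x₀, p (shift z)) ↔ ∀ᶠ z in zUltrafilter D x₀, p z := by
  obtain ⟨T, hT, hp⟩ := hp
  exact preimage_shift_mem_zUltrafilter D x₀ (s := {z | p z}) hT hp

end DependsOnFinite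

variable {L : FirstOrder.Language.{u, v}} {U : Type w} [L.Structure U]

variable (L) in
/-- The `ℤ`-fold iterated ultrapower of `U` along `D`, as a substructure of an ultrapower: it
consists of the classes of functions depending on finitely many coordinates. -/
def iteratedUltrapower (D : Ultrafilter U) (x₀ : U) :
    L.Substructure ((zUltrafilter D x₀ : Filter (ℤ → U)).Product fun _ => U) where
  carrier := {p | ∃ f : (ℤ → U) → U, DependsOnFinite f ∧
    p = (f : (zUltrafilter D x₀ : Filter (ℤ → U)).Product fun _ => U)}
  fun_mem := by
    intro n F x hx
    choose f hf hxf using hx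
    refine ⟨fun z => funMap F fun i => f i z, (DependsOnFinite.pi hf).comp _, ?_⟩
    rw [← Ultraproduct.funMap_cast]
    exact congrArg _ (funext hxf)

theorem iteratedUltrapower_isElementary (D : Ultrafilter U) (x₀ : U) :
    (iteratedUltrapower L D x₀).IsElementary := by
  have : Nonempty U := ⟨x₀⟩
  refine Substructure.isElementary_of_exists _ fun n φ x a h => ?_
  choose f hf hxf using fun i => (x i).2
  have hx : (Subtype.val ∘ x) = fun i =>
      ((f i : (ℤ → U) → U) : (zUltrafilter D x₀ : Filter (ℤ → U)).Product fun _ => U) :=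
    funext hxf
  have key : ∀ g : (ℤ → U) → U, φ.Realize default (Fin.snoc (Subtype.val ∘ x)
      (g : (zUltrafilter D x₀ : Filter (ℤ → U)).Product fun _ => U)) ↔
      ∀ᶠ z in zUltrafilter D x₀, φ.Realize default (Fin.snoc (fun i => f i z) (g z)) := by
    intro g
    have h1 := Ultraproduct.boundedFormula_realize_cast (u := zUltrafilter D x₀)
      (M := fun _ => U) φ Empty.elim (Fin.snoc f g : Fin (n + 1) → (ℤ → U) → U)
    let mk : ((ℤ → U) → U) → (zUltrafilter D x₀ : Filter (ℤ → U)).Product fun _ => U :=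
      fun p => p
    have e1 : (Fin.snoc (Subtype.val ∘ x) (mk g) : Fin (n + 1) → _) =
        mk ∘ (Fin.snoc f g : Fin (n + 1) → (ℤ → U) → U) := by
      rw [hx, Fin.comp_snoc]
      rfl
    have e2 : ∀ z, (fun i => (Fin.snoc f g : Fin (n + 1) → (ℤ → U) → U) i z) =
        (Fin.snoc (fun i => f i z) (g z) : Fin (n + 1) → U) := by
      intro z
      ext i
      refine Fin.lastCases ?_ (fun i => ?_) i <;> simp
    simp only [e2] at h1
    have e3 : ∀ z : ℤ → U, (default : Empty → U) = fun i =>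
        (Empty.elim i : (ℤ → U) → U) z :=
      fun _ => Subsingleton.elim _ _
    have e4 : (default : Empty → _) = fun i => mk (Empty.elim i) := Subsingleton.elim _ _
    change φ.Realize default (Fin.snoc (Subtype.val ∘ x) (mk g)) ↔ _
    rw [e1, e4]
    refine h1.trans (eventually_congr (.of_forall fun z => ?_))
    rw [e3 z]
  obtain ⟨g, rfl⟩ := Quotient.exists_rep a
  let w : (Fin n → U) → U := fun y =>
    Classical.epsilon fun c => φ.Realize default (Fin.snoc y c : Fin (n + 1) → U)
  refine ⟨⟨_, fun z => w fun i => f i z, (DependsOnFinite.pi hf).comp w, rfl⟩,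
    (key _).2 ?_⟩
  filter_upwards [(key g).1 h] with z hz
  exact Classical.epsilon_spec (p := fun c => φ.Realize default (Fin.snoc _ c)) ⟨_, hz⟩

theorem realize_iteratedUltrapower {D : Ultrafilter U} {x₀ : U} {γ : Type*} (φ : L.Formula γ)
    {x : γ → iteratedUltrapower L D x₀} {f : γ → (ℤ → U) → U}
    (hx : ∀ i, (x i : (zUltrafilter D x₀ : Filter (ℤ → U)).Product fun _ => U) = f i) :
    φ.Realize x ↔ ∀ᶠ z in zUltrafilter D x₀, φ.Realize fun i => f i z := by
  have : Nonempty U := ⟨x₀⟩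
  let S : L.ElementarySubstructure _ := ⟨_, iteratedUltrapower_isElementary (L := L) D x₀⟩
  rw [← Ultraproduct.realize_formula_cast (u := zUltrafilter D x₀) (M := fun _ => U) φ f,
    ← funext hx]
  exact (S.subtype.map_formula φ x).symm

/-- The type of an element over an elementary substructure `U` is the limit, along an
ultrafilter, of types of elements of `U`. -/
theorem exists_ultrafilter_realize {V : Type*} [L.Structure V] (e : U ↪ₑ[L] V) (u : V) :
    ∃ D : Ultrafilter U, ∀ φ : L.Formula (Option U),
      φ.Realize (fun o => o.elim u e) → ∀ᶠ y in D, φ.Realize fun o => o.elim y id := by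
  let F : Filter U :=
    { sets := {s | ∃ φ : L.Formula (Option U), φ.Realize (fun o => o.elim u e) ∧
        ∀ y, φ.Realize (fun o => o.elim y id) → y ∈ s}
      univ_sets := ⟨⊤, by simp [Formula.Realize], fun _ _ => trivial⟩
      sets_of_superset := fun ⟨φ, h, hs⟩ hst => ⟨φ, h, fun y hy => hst (hs y hy)⟩
      inter_sets := fun ⟨φ, h, hs⟩ ⟨ψ, h', hs'⟩ => ⟨φ ⊓ ψ, Formula.realize_inf.2 ⟨h, h'⟩,
        fun y hy => ⟨hs y (Formula.realize_inf.1 hy).1, hs' y (Formula.realize_inf.1 hy).2⟩⟩ }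
  have hF : F.NeBot := by
    refine ⟨fun hbot => ?_⟩
    have hempty : ∅ ∈ F := by rw [hbot]; exact mem_bot
    obtain ⟨φ, hφ, hs⟩ := hempty
    let ψ : L.Formula (U ⊕ Unit) := φ.relabel fun o => o.elim (Sum.inr ()) Sum.inl
    have hψ : (ψ.iExs Unit).Realize (e ∘ id) := by
      refine Formula.realize_iExs.2 ⟨fun _ => u, Formula.realize_relabel.2 ?_⟩
      convert hφ using 1
      ext (_ | _) <;> rfl
    obtain ⟨y, hy⟩ := Formula.realize_iExs.1 ((e.map_formula _ _).1 hψ)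
    refine hs (y ()) ?_
    convert Formula.realize_relabel.1 hy using 1
    ext (_ | _) <;> rfl
  exact ⟨Ultrafilter.of F, fun φ hφ => Ultrafilter.of_le F ⟨φ, hφ, fun _ h => h⟩⟩

/-- If `u` lies outside of the elementary substructure `U`, then the type of `u` over `U` is
realized in some structure with an automorphism (given by its graph) that fixes `U` pointwise and
moves the realization. -/
theorem exists_model_relation {V : Type*} [L.Structure V] (e : U ↪ₑ[L] V) {u : V}
    (hu : u ∉ Set.range e) :
    ∃ (N : Type w) (_ : L.Structure N) (j : U → N) (t : N) (R : N → N → Prop),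
      (∀ φ : L.Formula (Option U),
        φ.Realize (fun o => o.elim u e) ↔ φ.Realize (fun o => o.elim t j)) ∧
      (∀ x, ∃ y, R x y) ∧ (∀ y, ∃ x, R x y) ∧
      (∀ (n : ℕ) (ψ : L.Formula (Fin n)) (x y : Fin n → N),
        (∀ i, R (x i) (y i)) → (ψ.Realize x ↔ ψ.Realize y)) ∧
      (∀ c, R (j c) (j c)) ∧ ¬ R t t := by
  obtain ⟨D, hD⟩ := exists_ultrafilter_realize e u
  obtain ⟨x₀⟩ : Nonempty U := D.nonempty_of_neBot
  have hne : ∀ c, ∀ᶠ y in D, y ≠ c := fun c => by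
    have key := hD ((Term.var none).equal (Term.var (some c))).not
      (by simpa using fun h => hu ⟨c, h.symm⟩)
    simpa using key
  let mk : ∀ f : (ℤ → U) → U, DependsOnFinite f → iteratedUltrapower L D x₀ :=
    fun f hf => ⟨_, f, hf, rfl⟩
  refine ⟨iteratedUltrapower L D x₀, inferInstance, fun c => mk _ (.const c),
    mk _ (.apply 0), fun x y => ∃ f, ∃ hf : DependsOnFinite f,
      x = mk f hf ∧ y = mk (fun z => f (shift z)) (hf.comp_add 1), ?_, ?_, ?_, ?_, ?_, ?_⟩
  · have key : ∀ φ : L.Formula (Option U), φ.Realize (fun o => o.elim u e) →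
        φ.Realize (fun o : Option U => o.elim (mk _ (.apply 0)) fun c => mk _ (.const c)) := by
      intro φ hφ
      refine (realize_iteratedUltrapower φ
        (f := fun o z => o.elim (z 0) id) (by rintro (_ | _) <;> rfl)).2 ?_
      refine mem_zUltrafilter_of_eventually D x₀ (j := 0)
        (s := {z | φ.Realize fun o => o.elim (z 0) id})
        (fun x y h => ?_) fun x => ?_
      · simp [h 0 (by simp)]
      · simpa using hD φ hφ
    refine fun φ => ⟨key φ, fun h => ?_⟩
    by_contra hn
    exact Formula.realize_not.1 (key φ.not (Formula.realize_not.2 hn)) h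
  · rintro ⟨_, f, hf, rfl⟩
    exact ⟨_, f, hf, rfl, rfl⟩
  · rintro ⟨_, f, hf, rfl⟩
    refine ⟨_, _, hf.comp_add (-1), rfl, ?_⟩
    simp [mk, shift]
  · intro n ψ x y h
    choose f hf hx hy using h
    rw [realize_iteratedUltrapower ψ (f := f) fun i => congrArg Subtype.val (hx i),
      realize_iteratedUltrapower ψ (f := fun i z => f i (shift z)) fun i => congrArg Subtype.val (hy i)]
    exact (((DependsOnFinite.pi hf).comp fun v => ψ.Realize v).eventually_shift D x₀).symm
  · exact fun c => ⟨_, .const c, rfl, rfl⟩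
  · rintro ⟨f, hf, h0, h1⟩
    have h0' : ∀ᶠ z in zUltrafilter D x₀, z 0 = f z :=
      Quotient.exact (congrArg Subtype.val h0)
    have h1' : ∀ᶠ z in zUltrafilter D x₀, z 0 = f (shift z) :=
      Quotient.exact (congrArg Subtype.val h1)
    have hdep : DependsOnFinite fun z : ℤ → U => z 0 = f z :=
      (DependsOnFinite.pi (f := fun b z => cond b (z 0) (f z))
        (by rintro (_ | _); exacts [hf, .apply 0])).comp fun v => v true = v false
    have h2 : ∀ᶠ z : ℤ → U in zUltrafilter D x₀, z 1 ≠ z 0 := by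
      refine mem_zUltrafilter_of_eventually D x₀ (j := 1) (s := {z | z 1 ≠ z 0})
        (fun x y h => ?_) fun x => ?_
      · simp [h 0 (by simp), h 1 (by simp)]
      · simpa using hne (x 0)
    obtain ⟨z, hz1, hz2, hz3⟩ := (h1'.and (((hdep.eventually_shift D x₀).2 h0').and h2)).exists
    exact hz3 (hz2.trans hz1.symm)

end IteratedUltrapower

/-- Let `U` be a countable saturated structure and `Û` a `λ`-big elementary
extension of `U` for a sufficiently large uncountable cardinal `λ`. Then every element of
`Û ∖ U` is moved by some automorphism of `Û` that fixes `U` pointwise. -/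
theorem statement_17 (L : FirstOrder.Language.{u, v}) (U : Type w) [L.Structure U] [Countable U]
    (hsat : IsSaturated L U) (lam : Cardinal.{w}) (hlam : ℵ₀ < lam)
    (Uh : Type w) [L.Structure Uh] (e : U ↪ₑ[L] Uh) (hbig : IsBig L Uh lam) :
    ∀ u : Uh, u ∉ Set.range ⇑e →
      ∃ α : Uh ≃[L] Uh, (∀ x : U, α (e x) = e x) ∧ α u ≠ u := by
  intro u hu
  obtain ⟨N, SN, j, t, R, hequiv, hl, hr, hR, hj, ht⟩ := exists_model_relation e hu
  let a : Option U → Uh := fun o => o.elim u e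
  let b : Option U → N := fun o => o.elim t j
  let : (constantsOn (Option U)).Structure Uh := constantsOn.structure a
  let : (constantsOn (Option U)).Structure N := constantsOn.structure b
  have hcard : #(Option U) < lam := (mk_le_aleph0 (α := Option U)).trans_lt hlam
  have hN : Uh ≅[L[[Option U]]] N := by
    refine elementarilyEquivalent_iff.2 fun φ => ?_
    rw [← Formula.realize_equivSentence_symm_con, ← Formula.realize_equivSentence_symm_con]
    exact hequiv _
  obtain ⟨RM, hRM⟩ := hbig (Option U) hcard a 2 N inferInstance {x | R (x 0) (x 1)} hN
  let : (oneRel 2).Structure N := oneRelStructure {x | R (x 0) (x 1)}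
  let : (oneRel 2).Structure Uh := oneRelStructure RM
  let ρ : ((L[[Option U]]).sum (oneRel 2)).Relations 2 := Sum.inr ⟨rfl⟩
  have hρ : ∀ x y : N, Structure.RelMap ρ ![x, y] ↔ R x y := fun x y => Iff.rfl
  let φ : L →ᴸ (L[[Option U]]).sum (oneRel 2) :=
    LHom.sumInl.comp (L.lhomWithConstants (Option U))
  have : φ.IsExpansionOn Uh := ⟨fun _ _ => rfl, fun _ _ => rfl⟩
  have : φ.IsExpansionOn N := ⟨fun _ _ => rfl, fun _ _ => rfl⟩
  obtain ⟨g, hg⟩ := exists_equiv_of_relMap φ hRM ρ (by simpa only [hρ]) (by simpa only [hρ])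
    (by simpa only [hρ])
  have hconst : ∀ o, g (a o) = a o ↔ R (b o) (b o) := by
    intro o
    rw [← hg, ← hρ]
    let c : ((L[[Option U]]).sum (oneRel 2)).Constants := Sum.inl (L.con o)
    have key := elementarilyEquivalent_iff.1 hRM (ρ.formula₂ c.term c.term)
    simp only [Sentence.Realize, Formula.realize_rel₂, Term.realize_constants] at key
    have ha : (c : Uh) = a o := rfl
    have hb : (c : N) = b o := rfl
    rwa [ha, hb] at key
  exact ⟨g, fun x => (hconst (some x)).2 (hj x), fun h => ht ((hconst none).1 h)⟩

end Paper
end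

section
/- Let A be a smooth countable saturated structure. Then for every self-embedding ι of A there exist self-embeddings α and β of A such that α = β ∘ ι and such that the images of both α and β are superhomogeneous substructures of A. -/
open FirstOrder Language Set Cardinal Topology

universe u v w

namespace Paper

variable (L : FirstOrder.Language.{u, v}) (M : Type w) [L.Structure M]

variable (L : FirstOrder.Language.{u, v}) (M : Type w) [L.Structure M]

section

/-- Countably many one-point extension steps can be iterated along an increasing sequence of
relations so as to meet prescribed countable sets of domain and range elements. -/
theorem exists_monotone_seq_of_back_and_forth {X Y : Type*} (Q : Set (X × Y) → Prop)
    {R₀ : Set (X × Y)} (hR₀ : Q R₀) {S : Set X} {T : Set Y} (hS : S.Countable) (hT : T.Countable)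
    (forth : ∀ R, Q R → ∀ x ∈ S, ∃ y, Q (insert (x, y) R))
    (back : ∀ R, Q R → ∀ y ∈ T, ∃ x, Q (insert (x, y) R)) :
    ∃ R : ℕ → Set (X × Y), Monotone R ∧ R 0 = R₀ ∧ (∀ n, Q (R n)) ∧
      (∀ x ∈ S, ∃ n y, (x, y) ∈ R n) ∧ (∀ y ∈ T, ∃ n x, (x, y) ∈ R n) := by
  have := hS.to_subtype
  have := hT.to_subtype
  have := Encodable.ofCountable (S ⊕ T)
  let 𝒟 : S ⊕ T → Order.Cofinal {R : Set (X × Y) // Q R} := fun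
    | .inl x => ⟨{R | ∃ y, (x.1, y) ∈ R.1}, fun R => by
        obtain ⟨y, hy⟩ := forth R.1 R.2 x x.2
        exact ⟨⟨_, hy⟩, ⟨y, mem_insert _ _⟩, subset_insert _ _⟩⟩
    | .inr y => ⟨{R | ∃ x, (x, y.1) ∈ R.1}, fun R => by
        obtain ⟨x, hx⟩ := back R.1 R.2 y y.2
        exact ⟨⟨_, hx⟩, ⟨x, mem_insert _ _⟩, subset_insert _ _⟩⟩
  let s := Order.sequenceOfCofinals (⟨R₀, hR₀⟩ : {R : Set (X × Y) // Q R}) 𝒟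
  refine ⟨fun n => (s n).1, fun m n h => Order.sequenceOfCofinals.monotone _ 𝒟 h, rfl,
    fun n => (s n).2, fun x hx => ?_, fun y hy => ?_⟩
  · exact ⟨_, Order.sequenceOfCofinals.encode_mem _ 𝒟 (Sum.inl ⟨x, hx⟩)⟩
  · exact ⟨_, Order.sequenceOfCofinals.encode_mem _ 𝒟 (Sum.inr ⟨y, hy⟩)⟩

end

section

variable {L : FirstOrder.Language.{u, v}} {C : Type w} [L.Structure C]

/-- A binary relation on a structure is partial elementary if related tuples satisfy the same
formulas. -/
def PartialElementary (L : FirstOrder.Language.{u, v}) {C : Type w} [L.Structure C]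
    (R : Set (C × C)) : Prop :=
  ∀ (n : ℕ) (φ : L.Formula (Fin n)) (v : Fin n → C × C), (∀ i, v i ∈ R) →
    (φ.Realize (fun i => (v i).1) ↔ φ.Realize (fun i => (v i).2))

namespace PartialElementary

theorem mono {R S : Set (C × C)} (hS : PartialElementary L S) (h : R ⊆ S) :
    PartialElementary L R :=
  fun n φ v hv => hS n φ v fun i => h (hv i)

theorem realize_iff {R : Set (C × C)} (hR : PartialElementary L R) {α : Type*}
    (φ : L.Formula α) (v : α → C × C) (hv : ∀ i, v i ∈ R) :
    φ.Realize (fun i => (v i).1) ↔ φ.Realize (fun i => (v i).2) := by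
  classical
  let e := Fintype.equivFin φ.freeVarFinset
  have key : ∀ u : α → C, φ.Realize u ↔
      Formula.Realize (BoundedFormula.restrictFreeVar φ e) fun i => u (e.symm i) := fun u =>
    (BoundedFormula.realize_restrictFreeVar (f := e) (v := fun i => u (e.symm i)) u
      (by simp)).symm
  rw [key, key]
  exact hR _ _ (fun i => v (e.symm i)) fun i => hv _

theorem swap {R : Set (C × C)} (hR : PartialElementary L R) :
    PartialElementary L (Prod.swap ⁻¹' R) :=
  fun n φ v hv => (hR n φ (fun i => (v i).swap) hv).symm

theorem iUnion {R : ℕ → Set (C × C)} (hm : Monotone R) (hR : ∀ n, PartialElementary L (R n)) :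
    PartialElementary L (⋃ n, R n) := by
  intro n φ v hv
  simp only [mem_iUnion] at hv
  choose k hk using hv
  exact hR (Finset.univ.sup k) n φ v fun i => hm (Finset.le_sup (Finset.mem_univ i)) (hk i)

theorem eq_iff {R : Set (C × C)} (hR : PartialElementary L R) {p q : C × C} (hp : p ∈ R)
    (hq : q ∈ R) : p.1 = q.1 ↔ p.2 = q.2 := by
  have := hR.realize_iff (((Term.var 0).equal (Term.var 1)) : L.Formula (Fin 2)) ![p, q]
    (by simp [Fin.forall_fin_two, hp, hq])
  simpa [Formula.realize_equal] using this

theorem of_eq {R : Set (C × C)} (h : ∀ p ∈ R, p.1 = p.2) : PartialElementary L R := by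
  intro n φ v hv
  rw [show (fun i => (v i).1) = fun i => (v i).2 from funext fun i => h _ (hv i)]

/-- A relation together with one more pair is partial elementary as soon as it is so for formulas
indexed by the relation and one more variable. -/
theorem insert_of {R : Set (C × C)} {b c : C}
    (h : ∀ φ : L.Formula (R ⊕ Unit), φ.Realize (Sum.elim (fun r => r.1.1) fun _ => b) →
      φ.Realize (Sum.elim (fun r => r.1.2) fun _ => c)) :
    PartialElementary L (insert (b, c) R) := by
  classical
  have h' : ∀ φ : L.Formula (R ⊕ Unit), φ.Realize (Sum.elim (fun r => r.1.1) fun _ => b) ↔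
      φ.Realize (Sum.elim (fun r => r.1.2) fun _ => c) := fun φ =>
    ⟨h φ, fun hc => by
      by_contra hb
      exact h φ.not hb hc⟩
  intro n φ v hv
  let f : Fin n → R ⊕ Unit := fun i => if hi : v i ∈ R then Sum.inl ⟨v i, hi⟩ else Sum.inr ()
  have := h' (φ.relabel f)
  rw [Formula.realize_relabel, Formula.realize_relabel] at this
  convert this using 2
  · funext i
    by_cases hi : v i ∈ R
    · simp [f, hi]
    · simp only [f, Function.comp_apply, dif_neg hi, Sum.elim_inr]
      rw [(mem_insert_iff.1 (hv i)).resolve_right hi]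
  · funext i
    by_cases hi : v i ∈ R
    · simp [f, hi]
    · simp only [f, Function.comp_apply, dif_neg hi, Sum.elim_inr]
      rw [(mem_insert_iff.1 (hv i)).resolve_right hi]

end PartialElementary

/-- Countable saturation: countable sets of parameters suffice. -/
def CountablySaturated (L : FirstOrder.Language.{u, v}) (C : Type w) [L.Structure C] : Prop :=
  ∀ (α : Type w) [Countable α] (a : α → C) (Φ : Set (L.Formula (α ⊕ Unit))),
    (∀ s : Finset (L.Formula (α ⊕ Unit)), ↑s ⊆ Φ →
      ∃ x, ∀ φ ∈ s, φ.Realize (Sum.elim a fun _ => x)) →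
    ∃ x, ∀ φ ∈ Φ, φ.Realize (Sum.elim a fun _ => x)

/-- The formula asserting that some element satisfies all formulas of a finite set. -/
noncomputable def exsFinset {α : Type*} (s : Finset (L.Formula (α ⊕ Unit))) : L.Formula α :=
  (Formula.iInf fun φ : s => φ.1).iExs Unit

theorem realize_exsFinset {α : Type*} (s : Finset (L.Formula (α ⊕ Unit))) (a : α → C) :
    (exsFinset s).Realize a ↔ ∃ x, ∀ φ ∈ s, φ.Realize (Sum.elim a fun _ => x) := by
  simp only [exsFinset, Formula.realize_iExs, Formula.realize_iInf, Subtype.forall]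
  exact ⟨fun ⟨i, hi⟩ => ⟨i (), hi⟩, fun ⟨x, hx⟩ => ⟨fun _ => x, hx⟩⟩

/-- Ultrapowers along a non-principal ultrafilter on `ℕ` are countably saturated. -/
theorem countablySaturated_ultrapower [Countable L.Symbols] {A : Type w} [L.Structure A]
    [Nonempty A] :
    CountablySaturated L ((Filter.hyperfilter ℕ : Filter ℕ).Product fun _ : ℕ => A) := by
  classical
  intro α _ a Φ hΦ
  rcases Φ.eq_empty_or_nonempty with rfl | hne
  · obtain ⟨x, -⟩ := hΦ ∅ (by simp)
    exact ⟨x, by simp⟩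
  obtain ⟨φ, rfl⟩ := (Set.to_countable Φ).exists_eq_range hne
  choose b hb using fun i => Quotient.exists_rep (a i)
  obtain rfl : (fun i => Quotient.mk _ (b i)) = a := funext hb
  have key : ∀ (i : ℕ) (x : ℕ → A),
      (φ i).Realize (Sum.elim (fun i => Quotient.mk _ (b i)) fun _ =>
        (Quotient.mk _ x : (Filter.hyperfilter ℕ : Filter ℕ).Product fun _ : ℕ => A)) ↔
      ∀ᶠ n in (Filter.hyperfilter ℕ : Filter ℕ),
        (φ i).Realize (Sum.elim (fun j => b j n) fun _ => x n) := by
    intro i x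
    have := Ultraproduct.realize_formula_cast (u := Filter.hyperfilter ℕ) (M := fun _ : ℕ => A)
      (φ i) (Sum.elim b fun _ => x)
    convert this using 2
    · funext j; rcases j with j | j <;> rfl
    · funext n
      congr! 1
      funext j; rcases j with j | j <;> rfl
  let G : ℕ → ℕ → Prop := fun n k => ∃ x : A, ∀ i < k,
    (φ i).Realize (Sum.elim (fun j => b j n) fun _ => x)
  have hG0 : ∀ n, G n 0 := fun n => ⟨Classical.arbitrary A, by simp⟩
  have hG : ∀ k, ∀ᶠ n in (Filter.hyperfilter ℕ : Filter ℕ), G n k := by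
    intro k
    obtain ⟨x, hx⟩ := hΦ ((Finset.range k).image φ) (by
      intro ψ hψ
      obtain ⟨i, -, rfl⟩ := Finset.mem_image.1 hψ
      exact mem_range_self i)
    obtain ⟨x, rfl⟩ := Quotient.exists_rep x
    have : ∀ i ∈ Finset.range k, ∀ᶠ n in (Filter.hyperfilter ℕ : Filter ℕ),
        (φ i).Realize (Sum.elim (fun j => b j n) fun _ => x n) := fun i hi =>
      (key i x).1 (hx _ (Finset.mem_image_of_mem φ hi))
    filter_upwards [(Filter.eventually_all_finset _).2 this] with n hn
    exact ⟨x n, fun i hi => hn i (Finset.mem_range.2 hi)⟩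
  have hK : ∀ n, G n (Nat.findGreatest (G n) n) := fun n =>
    Nat.findGreatest_spec (Nat.zero_le n) (hG0 n)
  choose x hx using hK
  refine ⟨Quotient.mk _ x, ?_⟩
  rintro _ ⟨i, rfl⟩
  refine (key i x).2 ?_
  have hlarge : ∀ᶠ n in (Filter.hyperfilter ℕ : Filter ℕ), i + 1 ≤ n :=
    Nat.hyperfilter_le_atTop (Filter.eventually_ge_atTop (i + 1))
  filter_upwards [hlarge, hG (i + 1)] with n hn hGn
  exact hx n i (Nat.le_findGreatest hn hGn)

/-- The diagonal embedding of a structure into its ultrapower. -/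
noncomputable def diagonalEmbedding (L : FirstOrder.Language.{u, v}) (A : Type w) [L.Structure A]
    [Nonempty A] :
    A ↪ₑ[L] ((Filter.hyperfilter ℕ : Filter ℕ).Product fun _ : ℕ => A) where
  toFun a := Quotient.mk _ fun _ => a
  map_formula' n φ x := by
    have := Ultraproduct.realize_formula_cast (u := Filter.hyperfilter ℕ) (M := fun _ : ℕ => A)
      φ fun i _ => x i
    rw [Filter.eventually_const] at this
    exact this

namespace PartialElementary

theorem exists_insert (hC : CountablySaturated L C) {R : Set (C × C)} (hc : R.Countable)
    (hR : PartialElementary L R) (b : C) : ∃ c, PartialElementary L (insert (b, c) R) := by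
  have := hc.to_subtype
  obtain ⟨c, hc⟩ := hC R (fun r => r.1.2)
    {φ | φ.Realize (Sum.elim (fun r => r.1.1) fun _ => b)} (fun s hs => by
      rw [← realize_exsFinset, ← hR.realize_iff (exsFinset s) (fun r : R => r.1) fun r => r.2,
        realize_exsFinset]
      exact ⟨b, fun φ hφ => hs hφ⟩)
  exact ⟨c, insert_of fun φ hφ => hc φ hφ⟩

theorem insert_of_swap {R : Set (C × C)} {b c : C}
    (h : PartialElementary L (insert (b, c) (Prod.swap ⁻¹' R))) :
    PartialElementary L (insert (c, b) R) := by
  refine h.swap.mono ?_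
  rintro p (rfl | hp)
  · exact Or.inl rfl
  · exact Or.inr hp

theorem exists_insert_left (hC : CountablySaturated L C) {R : Set (C × C)} (hc : R.Countable)
    (hR : PartialElementary L R) (b : C) : ∃ c, PartialElementary L (insert (c, b) R) :=
  let ⟨c, h⟩ := hR.swap.exists_insert hC (hc.preimage Prod.swap_injective) b
  ⟨c, h.insert_of_swap⟩

theorem exists_countable_extension (hC : CountablySaturated L C) {R : Set (C × C)}
    (hR : PartialElementary L R) (hc : R.Countable) {S : Set C} (hS : S.Countable) :
    ∃ R' : Set (C × C), (PartialElementary L R' ∧ R'.Countable) ∧ R ⊆ R' ∧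
      ∀ x ∈ S, (∃ y, (x, y) ∈ R') ∧ ∃ y, (y, x) ∈ R' := by
  obtain ⟨T, hm, rfl, hQ, h₁, h₂⟩ := exists_monotone_seq_of_back_and_forth
    (fun R : Set (C × C) => PartialElementary L R ∧ R.Countable) ⟨hR, hc⟩ hS hS
    (fun R hR x _ => (hR.1.exists_insert hC hR.2 x).imp fun y h => ⟨h, hR.2.insert _⟩)
    (fun R hR x _ => (hR.1.exists_insert_left hC hR.2 x).imp fun y h => ⟨h, hR.2.insert _⟩)
  refine ⟨⋃ n, T n, ⟨iUnion hm fun n => (hQ n).1, countable_iUnion fun n => (hQ n).2⟩,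
    subset_iUnion T 0, fun x hx => ⟨?_, ?_⟩⟩
  · obtain ⟨n, y, h⟩ := h₁ x hx
    exact ⟨y, mem_iUnion.2 ⟨n, h⟩⟩
  · obtain ⟨n, y, h⟩ := h₂ x hx
    exact ⟨y, mem_iUnion.2 ⟨n, h⟩⟩

/-- Over a countable elementary submodel, an outside element has another realization of its
type. -/
theorem exists_insert_diagonal_ne (hC : CountablySaturated L C) {A : Type w} [L.Structure A]
    [Countable A] (j : A ↪ₑ[L] C) {y : C} (hy : y ∉ range j) :
    ∃ z, z ≠ y ∧ PartialElementary L (insert (y, z) {p : C × C | p.1 ∈ range j ∧ p.1 = p.2}) := by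
  classical
  let up : L.Formula (A ⊕ Unit) → L.Formula (Option A ⊕ Unit) :=
    fun φ => φ.relabel (Sum.map some id)
  have hup : ∀ φ (z : C), (up φ).Realize
      (Sum.elim (fun o : Option A => o.elim y j) fun _ => z) ↔
      φ.Realize (Sum.elim j fun _ => z) := by
    intro φ z
    rw [Formula.realize_relabel]
    congr! 1
    funext i
    rcases i with i | i <;> rfl
  let ne : L.Formula (Option A ⊕ Unit) :=
    ((Term.var (Sum.inr ())).equal (Term.var (Sum.inl none))).not
  have hne : ∀ z : C, ne.Realize (Sum.elim (fun o : Option A => o.elim y j) fun _ => z) ↔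
      z ≠ y := by
    intro z
    simp [ne, Formula.realize_not, Formula.realize_equal]
  obtain ⟨z, hz⟩ := hC (Option A) (fun o => o.elim y j)
    (insert ne (up '' {φ | φ.Realize (Sum.elim j fun _ => y)})) (fun s hs => by
      let t : Set (L.Formula (A ⊕ Unit)) := {φ | φ.Realize (Sum.elim j fun _ => y)}
      obtain ⟨t', ht', hst⟩ : ∃ t' : Finset (L.Formula (A ⊕ Unit)),
          ↑t' ⊆ t ∧ (s.erase ne) = t'.image up := by
        have : ↑(s.erase ne) ⊆ up '' t := by
          intro ψ hψ
          have hψ := Finset.mem_erase.1 hψ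
          exact (mem_insert_iff.1 (hs hψ.2)).resolve_left hψ.1
        obtain ⟨t', ht', h⟩ := Finset.subset_set_image_iff.1 this
        exact ⟨t', ht', h.symm⟩
      have h₁ : (exsFinset t').Realize j := (realize_exsFinset t' j).2 ⟨y, fun φ hφ => ht' hφ⟩
      have h₂ : (exsFinset t').Realize (id : A → A) := (j.map_formula (exsFinset t') id).1 h₁
      obtain ⟨x, hx⟩ := (realize_exsFinset t' id).1 h₂
      refine ⟨j x, fun ψ hψ => ?_⟩
      by_cases hψn : ψ = ne
      · rw [hψn, hne]
        rintro rfl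
        exact hy (mem_range_self x)
      · have : ψ ∈ t'.image up := hst ▸ Finset.mem_erase.2 ⟨hψn, hψ⟩
        obtain ⟨φ, hφ, rfl⟩ := Finset.mem_image.1 this
        rw [hup]
        have := (j.map_formula φ _).2 (hx φ hφ)
        convert this using 1
        funext i
        rcases i with i | i <;> rfl)
  refine ⟨z, (hne z).1 (hz _ (mem_insert _ _)), insert_of fun φ hφ => ?_⟩
  choose a ha using fun r : {p : C × C | p.1 ∈ range j ∧ p.1 = p.2} => r.2.1
  have e₁ : (fun r : {p : C × C | p.1 ∈ range j ∧ p.1 = p.2} => r.1.1) = fun r => j (a r) :=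
    funext fun r => (ha r).symm
  have e₂ : (fun r : {p : C × C | p.1 ∈ range j ∧ p.1 = p.2} => r.1.2) = fun r => j (a r) :=
    funext fun r => r.2.2.symm.trans (ha r).symm
  have key : ∀ w : C, φ.Realize (Sum.elim (fun r => j (a r)) fun _ => w) ↔
      Formula.Realize (φ.relabel (Sum.map a id)) (Sum.elim j fun _ => w) := by
    intro w
    rw [Formula.realize_relabel]
    congr! 1
    funext i
    rcases i with i | i <;> rfl
  rw [e₁, key] at hφ
  rw [e₂, key]
  exact (hup _ z).1 (hz _ (Or.inr ⟨_, hφ, rfl⟩))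

/-- A finite partial elementary relation into an elementary submodel that is saturated can be
extended to any further element of the domain. -/
theorem exists_insert_of_isSaturated (hC : CountablySaturated L C) {A : Type w} [L.Structure A]
    (hA : IsSaturated L A) (j : A ↪ₑ[L] C) {F : Set (C × C)} (hF : PartialElementary L F)
    (hfin : F.Finite) (hj : ∀ p ∈ F, p.2 ∈ range j) (w : C) :
    ∃ y ∈ range j, PartialElementary L (insert (w, y) F) := by
  obtain ⟨b, hb⟩ := hF.exists_insert hC hfin.countable w
  rcases finite_or_infinite A with hAf | hAi
  · refine ⟨b, ?_, hb⟩
    let φ : L.Formula A := (Formula.iInf fun a : A =>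
      (((Term.var (Sum.inr ())).equal (Term.var (Sum.inl a))).not : L.Formula (A ⊕ Unit))).iExs Unit
    have h₁ : ¬ φ.Realize (id : A → A) := by
      simp only [φ, Formula.realize_iExs, Formula.realize_iInf, Formula.realize_not,
        Formula.realize_equal, Term.realize_var, Sum.elim_inr, Sum.elim_inl, id, not_exists,
        not_forall, not_not]
      exact fun i => ⟨i (), rfl⟩
    rw [← j.map_formula φ id] at h₁
    simp only [φ, Formula.realize_iExs, Formula.realize_iInf, Formula.realize_not,
      Formula.realize_equal, Term.realize_var, Sum.elim_inr, Sum.elim_inl, not_exists,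
      not_forall, not_not] at h₁
    obtain ⟨a, ha⟩ := h₁ fun _ => b
    exact ⟨a, ha.symm⟩
  · choose a ha using fun r : F => hj r r.2
    have := hfin.to_subtype
    obtain ⟨c, hc⟩ := hA F ((lt_aleph0_of_finite F).trans_le (aleph0_le_mk A)) C _ j a b
    refine ⟨j c, mem_range_self c, insert_of fun φ hφ => ?_⟩
    have h₁ := (hb.realize_iff φ (Sum.elim (fun r => r.1) fun _ => (w, b)) (by
      rintro (r | r)
      · exact Or.inr r.2
      · exact Or.inl rfl)).1 (by
        convert hφ using 1
        funext i
        rcases i with i | i <;> rfl)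
    have h₂ := (hc φ).1 (by
      convert h₁ using 1
      funext i
      rcases i with i | i
      · exact ha i
      · rfl)
    convert (j.map_formula φ _).2 h₂ using 1
    funext i
    rcases i with i | i
    · exact (ha i).symm
    · rfl

end PartialElementary

/-- A partial elementary relation that relates all elements of `S` with all elements of `T`, that
is, the graph of a bijection from `S` to `T` preserving all formulas. -/
structure IsElementaryBijection (L : FirstOrder.Language.{u, v}) {C : Type w} [L.Structure C]
    (R : Set (C × C)) (S T : Set C) : Prop where
  partialElementary : PartialElementary L R
  subset : R ⊆ S ×ˢ T
  exists_right : ∀ x ∈ S, ∃ y, (x, y) ∈ R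
  exists_left : ∀ y ∈ T, ∃ x, (x, y) ∈ R

/-- One-point extensions of finite partial elementary relations yield an elementary bijection. -/
theorem exists_isElementaryBijection {S T : Set C} (hS : S.Countable) (hT : T.Countable)
    {F : Set (C × C)} (hF : PartialElementary L F) (hfin : F.Finite) (hsub : F ⊆ S ×ˢ T)
    (forth : ∀ R, PartialElementary L R → R.Finite → R ⊆ S ×ˢ T → ∀ x ∈ S,
      ∃ y ∈ T, PartialElementary L (insert (x, y) R))
    (back : ∀ R, PartialElementary L R → R.Finite → R ⊆ S ×ˢ T → ∀ y ∈ T,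
      ∃ x ∈ S, PartialElementary L (insert (x, y) R)) :
    ∃ R, F ⊆ R ∧ IsElementaryBijection L R S T := by
  obtain ⟨R, hm, rfl, hQ, h₁, h₂⟩ := exists_monotone_seq_of_back_and_forth
    (fun R : Set (C × C) => PartialElementary L R ∧ R.Finite ∧ R ⊆ S ×ˢ T) ⟨hF, hfin, hsub⟩ hS hT
    (fun R hR x hx => (forth R hR.1 hR.2.1 hR.2.2 x hx).imp fun y h =>
      ⟨h.2, hR.2.1.insert _, insert_subset ⟨hx, h.1⟩ hR.2.2⟩)
    (fun R hR y hy => (back R hR.1 hR.2.1 hR.2.2 y hy).imp fun x h =>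
      ⟨h.2, hR.2.1.insert _, insert_subset ⟨h.1, hy⟩ hR.2.2⟩)
  refine ⟨⋃ n, R n, subset_iUnion R 0, PartialElementary.iUnion hm fun n => (hQ n).1,
    iUnion_subset fun n => (hQ n).2.2, fun x hx => ?_, fun y hy => ?_⟩
  · obtain ⟨n, y, h⟩ := h₁ x hx
    exact ⟨y, mem_iUnion.2 ⟨n, h⟩⟩
  · obtain ⟨n, x, h⟩ := h₂ y hy
    exact ⟨x, mem_iUnion.2 ⟨n, h⟩⟩

/-- The image of a countable saturated structure under an elementary embedding is homogeneous. -/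
theorem exists_isElementaryBijection_range (hC : CountablySaturated L C) {A : Type w}
    [L.Structure A] [Countable A] (hA : IsSaturated L A) (j : A ↪ₑ[L] C) {F : Set (C × C)}
    (hF : PartialElementary L F) (hfin : F.Finite) (hsub : F ⊆ range j ×ˢ range j) :
    ∃ R, F ⊆ R ∧ IsElementaryBijection L R (range j) (range j) := by
  refine exists_isElementaryBijection (countable_range j) (countable_range j) hF hfin hsub
    (fun R hR hfin hsub x _ =>
      hR.exists_insert_of_isSaturated hC hA j hfin (fun p hp => (hsub hp).2) x)
    (fun R hR hfin hsub y _ => ?_)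
  obtain ⟨x, hx, h⟩ := hR.swap.exists_insert_of_isSaturated hC hA j
    (hfin.preimage Prod.swap_injective.injOn) (fun p hp => (hsub hp).1) y
  exact ⟨x, hx, h.insert_of_swap⟩

/-- Given countably many tasks for each finite relation, there is a countable set `W` such that
every task for a finite relation on `W` extends to an elementary permutation of `W`. -/
theorem exists_countable_closed (hC : CountablySaturated L C) {W₀ : Set C} (hW₀ : W₀.Countable)
    (𝒯 : Set (C × C) → Set (Set (C × C))) (h𝒯 : ∀ F, (𝒯 F).Countable) :
    ∃ W : Set C, W₀ ⊆ W ∧ W.Countable ∧ ∀ F : Set (C × C), F.Finite → F ⊆ W ×ˢ W →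
      ∀ R ∈ 𝒯 F, PartialElementary L R → R.Countable →
        ∃ R', R ⊆ R' ∧ IsElementaryBijection L R' W W := by
  have hext : ∀ (R : Set (C × C)) (S : Set C), ∃ R' : Set (C × C),
      (PartialElementary L R ∧ R.Countable) → S.Countable →
      (PartialElementary L R' ∧ R'.Countable) ∧ R ⊆ R' ∧
      ∀ x ∈ S, (∃ y, (x, y) ∈ R') ∧ ∃ y, (y, x) ∈ R' := by
    intro R S
    by_cases h : (PartialElementary L R ∧ R.Countable) ∧ S.Countable
    · obtain ⟨R', hR'⟩ := h.1.1.exists_countable_extension hC h.1.2 h.2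
      exact ⟨R', fun _ _ => hR'⟩
    · exact ⟨R, fun h₁ h₂ => absurd ⟨h₁, h₂⟩ h⟩
  choose ext hext using hext
  let tasks : Set C → Set (Set (C × C)) := fun W =>
    {R | (PartialElementary L R ∧ R.Countable) ∧ ∃ F, (F.Finite ∧ F ⊆ W ×ˢ W) ∧ R ∈ 𝒯 F}
  have htasks : ∀ W : Set C, W.Countable → (tasks W).Countable := fun W hW =>
    ((Set.countable_ofPred_finite_subset (hW.prod hW)).biUnion fun F _ => h𝒯 F).mono
      fun R ⟨_, F, hF, hR⟩ => mem_biUnion hF hR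
  let s : ℕ → Set C × (Set (C × C) → Set (C × C)) := fun n => Nat.rec (W₀, id)
    (fun _ s => (s.1 ∪ ⋃ R ∈ tasks s.1, (Prod.fst '' ext (s.2 R) s.1 ∪ Prod.snd '' ext (s.2 R) s.1),
      fun R => ext (s.2 R) s.1)) n
  let W : ℕ → Set C := fun n => (s n).1
  let E : ℕ → Set (C × C) → Set (C × C) := fun n => (s n).2
  have hWs : ∀ n, W (n + 1) = W n ∪ ⋃ R ∈ tasks (W n),
      (Prod.fst '' E (n + 1) R ∪ Prod.snd '' E (n + 1) R) := fun n => rfl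
  have hinv : ∀ n, (W n).Countable ∧ ∀ R, (PartialElementary L R ∧ R.Countable) →
      (PartialElementary L (E n R) ∧ (E n R).Countable) := by
    intro n
    induction n with
    | zero => exact ⟨hW₀, fun R hR => hR⟩
    | succ n ih =>
      have hE : ∀ R, (PartialElementary L R ∧ R.Countable) →
          (PartialElementary L (E (n + 1) R) ∧ (E (n + 1) R).Countable) := fun R hR =>
        (hext (E n R) (W n) (ih.2 R hR) ih.1).1
      refine ⟨?_, hE⟩
      rw [hWs]
      exact ih.1.union ((htasks _ ih.1).biUnion fun R hR =>
        ((hE R hR.1).2.image _).union ((hE R hR.1).2.image _))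
  have hWm : Monotone W := monotone_nat_of_le_succ fun n => subset_union_left
  have hstep : ∀ n R, (PartialElementary L R ∧ R.Countable) → E n R ⊆ E (n + 1) R ∧
      ∀ x ∈ W n, (∃ y, (x, y) ∈ E (n + 1) R) ∧ ∃ y, (y, x) ∈ E (n + 1) R := fun n R hR =>
    (hext (E n R) (W n) ((hinv n).2 R hR) (hinv n).1).2
  refine ⟨⋃ n, W n, subset_iUnion W 0, countable_iUnion fun n => (hinv n).1, ?_⟩
  intro F hF hFW R hR hpe hc
  have hgood : PartialElementary L R ∧ R.Countable := ⟨hpe, hc⟩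
  have hEm : Monotone fun n => E n R := monotone_nat_of_le_succ fun n => (hstep n R hgood).1
  obtain ⟨k, hk⟩ : ∃ k, F ⊆ W k ×ˢ W k := by
    have hdir : Directed (· ⊆ ·) fun n => W n ×ˢ W n :=
      directed_of_isDirected_le fun m n h => prod_mono (hWm h) (hWm h)
    have hsub : F ⊆ ⋃ n, W n ×ˢ W n := fun p hp => by
      obtain ⟨m, hm⟩ := mem_iUnion.1 (hFW hp).1
      obtain ⟨n, hn⟩ := mem_iUnion.1 (hFW hp).2
      exact mem_iUnion.2 ⟨max m n, hWm (le_max_left m n) hm, hWm (le_max_right m n) hn⟩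
    lift F to Finset (C × C) using hF
    exact hdir.exists_mem_subset_of_finset_subset_biUnion hsub
  refine ⟨⋃ n, E n R, subset_iUnion (fun n => E n R) 0,
    PartialElementary.iUnion hEm fun n => ((hinv n).2 R hgood).1, ?_, ?_, ?_⟩
  · refine iUnion_subset fun m p hp => ?_
    have hRt : R ∈ tasks (W (max m k)) := ⟨hgood, F,
      ⟨hF, hk.trans (prod_mono (hWm (le_max_right m k)) (hWm (le_max_right m k)))⟩, hR⟩
    have hp' : p ∈ E (max m k + 1) R := hEm ((le_max_left m k).trans (Nat.le_succ _)) hp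
    refine ⟨mem_iUnion.2 ⟨max m k + 1, ?_⟩, mem_iUnion.2 ⟨max m k + 1, ?_⟩⟩
    · rw [hWs]
      exact Or.inr (mem_biUnion hRt (Or.inl (mem_image_of_mem _ hp')))
    · rw [hWs]
      exact Or.inr (mem_biUnion hRt (Or.inr (mem_image_of_mem _ hp')))
  · intro x hx
    obtain ⟨n, hn⟩ := mem_iUnion.1 hx
    obtain ⟨y, hy⟩ := ((hstep n R hgood).2 x hn).1
    exact ⟨y, mem_iUnion.2 ⟨n + 1, hy⟩⟩
  · intro x hx
    obtain ⟨n, hn⟩ := mem_iUnion.1 hx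
    obtain ⟨y, hy⟩ := ((hstep n R hgood).2 x hn).2
    exact ⟨y, mem_iUnion.2 ⟨n + 1, hy⟩⟩

/-- The automorphism of an elementarily embedded structure induced by an elementary permutation
of its image. -/
theorem IsElementaryBijection.exists_equiv {A : Type w} [L.Structure A] (h : A ↪ₑ[L] C)
    {R : Set (C × C)} (hR : IsElementaryBijection L R (range h) (range h)) :
    ∃ g : A ≃[L] A, ∀ a b, (h a, h b) ∈ R ↔ g a = b := by
  have h₁ : ∀ a, ∃ b, (h a, h b) ∈ R := fun a => by
    obtain ⟨y, hy⟩ := hR.exists_right _ (mem_range_self a)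
    obtain ⟨b, rfl⟩ := (hR.subset hy).2
    exact ⟨b, hy⟩
  choose g hg using h₁
  have huniq : ∀ a a' b b', (h a, h b) ∈ R → (h a', h b') ∈ R → (a = a' ↔ b = b') :=
    fun a a' b b' p q => by
      simpa using hR.partialElementary.eq_iff p q
  let G : A ↪ₑ[L] A := ⟨g, fun n φ x => by
    rw [← h.map_formula, ← h.map_formula]
    exact (hR.partialElementary n φ (fun i => (h (x i), h (g (x i)))) fun i => hg _).symm⟩
  have hsurj : Function.Surjective g := fun b => by
    obtain ⟨x, hx⟩ := hR.exists_left _ (mem_range_self b)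
    obtain ⟨a, rfl⟩ := (hR.subset hx).1
    exact ⟨a, (huniq _ _ _ _ (hg a) hx).1 rfl⟩
  refine ⟨⟨Equiv.ofBijective g ⟨G.injective, hsurj⟩, fun f x => G.map_fun f x,
    fun r x => G.map_rel r x⟩, fun a b => ⟨fun hab => (huniq _ _ _ _ (hg a) hab).1 rfl, ?_⟩⟩
  rintro rfl
  exact hg a

/-- An elementary bijection from the image of an elementary embedding onto a set `T` yields an
elementary embedding with image `T`. -/
theorem IsElementaryBijection.exists_elementaryEmbedding {A : Type w} [L.Structure A]
    (d : A ↪ₑ[L] C) {R : Set (C × C)} {T : Set C}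
    (hR : IsElementaryBijection L R (range d) T) : ∃ h : A ↪ₑ[L] C, range h = T := by
  choose h hh using fun a => hR.exists_right _ (mem_range_self (f := d) a)
  refine ⟨⟨h, fun n φ x => ?_⟩, ?_⟩
  · rw [← d.map_formula]
    exact (hR.partialElementary n φ (fun i => (d (x i), h (x i))) fun i => hh _).symm
  · refine Subset.antisymm (range_subset_iff.2 fun a => (hR.subset (hh a)).2) fun y hy => ?_
    obtain ⟨x, hx⟩ := hR.exists_left y hy
    obtain ⟨a, rfl⟩ := (hR.subset hx).1
    exact ⟨a, (hR.partialElementary.eq_iff (hh a) hx).1 rfl⟩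

/-- An elementary embedding whose image lies in the image of another one factors through it. -/
theorem exists_elementaryEmbedding_comp_eq {A B : Type*} [L.Structure A] [L.Structure B]
    (h : A ↪ₑ[L] C) (d : B ↪ₑ[L] C) (hd : range d ⊆ range h) :
    ∃ β : B ↪ₑ[L] A, ∀ b, h (β b) = d b := by
  choose β hβ using fun b => hd (mem_range_self b)
  refine ⟨⟨β, fun n φ x => ?_⟩, hβ⟩
  rw [← h.map_formula, ← d.map_formula]
  exact iff_of_eq (congrArg _ (funext fun i => hβ (x i)))

/-- In the presence of quantifier elimination, any two embeddings into the structure realize the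
same formulas. -/
theorem HasQE.realize_iff {A B : Type*} [L.Structure A] [Nonempty A] [L.Structure B]
    (hQE : HasQE L A) (f g : B ↪[L] A) {n : ℕ} (φ : L.Formula (Fin n)) (x : Fin n → B) :
    φ.Realize (f ∘ x) ↔ φ.Realize (g ∘ x) := by
  obtain ⟨ψ, hψ, he⟩ := hQE n φ
  rw [he.realize_iff, he.realize_iff]
  have key : ∀ e : B ↪[L] A, ψ.Realize (e ∘ x) ↔ ψ.Realize x := fun e => by
    have := hψ.realize_embedding e (v := x) (xs := default)
    rwa [Subsingleton.elim (e ∘ default) (default : Fin 0 → A)] at this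
  rw [key, key]

/-- A criterion for superhomogeneity of the range of an embedding, in terms of elementary
permutations of an elementary image of the structure. -/
theorem isSuperhomogeneous_range {A : Type w} [L.Structure A] [Nonempty A] (hQE : HasQE L A)
    (h j : A ↪ₑ[L] C) (α : A ↪[L] A) (hα : ∀ a, h (α a) = j a)
    (hext : ∀ F : Set (C × C), PartialElementary L F → F.Finite → F ⊆ range j ×ˢ range j →
      ∃ R₁ R, F ⊆ R₁ ∧ R₁ ⊆ R ∧ IsElementaryBijection L R₁ (range j) (range j) ∧
        IsElementaryBijection L R (range h) (range h))
    (hmove : ∀ y ∈ range h, y ∉ range j → ∃ z R, z ≠ y ∧ (y, z) ∈ R ∧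
      (∀ x ∈ range j, (x, x) ∈ R) ∧ IsElementaryBijection L R (range h) (range h)) :
    IsSuperhomogeneous L A α.toHom.range := by
  have hmem : ∀ x : A, x ∈ α.toHom.range ↔ h x ∈ range j := by
    intro x
    rw [Hom.mem_range]
    constructor
    · rintro ⟨a, rfl⟩
      exact ⟨a, (hα a).symm⟩
    · rintro ⟨a, ha⟩
      exact ⟨a, h.injective ((hα a).trans ha)⟩
  refine ⟨fun S hS hfg f hf => ?_, fun y hy => ?_⟩
  · obtain ⟨t, rfl⟩ := hfg
    have ht : ∀ s : t, s.1 ∈ Substructure.closure L (t : Set A) := fun s =>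
      Substructure.subset_closure s.2
    let p : t → C × C := fun s => (h s, h (f ⟨s, ht s⟩))
    obtain ⟨R₁, R, hF, hR, hR₁, hRW⟩ := hext (range p) (by
      intro n φ v hv
      choose s hs using hv
      have := hQE.realize_iff (Substructure.subtype _) f φ fun i => ⟨s i, ht (s i)⟩
      rw [← h.map_formula, ← h.map_formula] at this
      convert this using 2
      · funext i
        rw [← hs i]
        rfl
      · funext i
        rw [← hs i]
        rfl) (finite_range p) (by
      rintro _ ⟨s, rfl⟩
      exact ⟨(hmem _).1 (hS (ht s)), (hmem _).1 (hf _)⟩)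
    obtain ⟨g, hg⟩ := hRW.exists_equiv h
    refine ⟨g, ?_, Subset.antisymm ?_ ?_⟩
    · rintro ⟨x, hx⟩
      refine Substructure.closure_induction' (L := L) (t : Set A) (p := fun x hx => g x = f ⟨x, hx⟩)
        (fun x hx => (hg _ _).1 (hR (hF (mem_range_self (⟨x, hx⟩ : t))))) ?_ hx
      intro n F v hv
      choose hv₁ hv₂ using hv
      refine ⟨Substructure.fun_mem _ F v hv₁, ?_⟩
      rw [g.map_fun, show g ∘ v = f ∘ fun i => ⟨v i, hv₁ i⟩ from funext hv₂, ← f.map_fun]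
      rfl
    · rintro _ ⟨x, hx, rfl⟩
      obtain ⟨y, hy⟩ := hR₁.exists_right _ ((hmem x).1 hx)
      obtain ⟨a, rfl⟩ := (hR₁.subset hy).2
      have := (hg x (α a)).1 (by rw [hα]; exact hR hy)
      rw [this]
      exact Hom.mem_range.2 ⟨a, rfl⟩
    · intro x hx
      obtain ⟨y, hy⟩ := hR₁.exists_left _ ((hmem x).1 hx)
      obtain ⟨a, rfl⟩ := (hR₁.subset hy).1
      exact ⟨α a, Hom.mem_range.2 ⟨a, rfl⟩, (hg (α a) x).1 (by rw [hα]; exact hR hy)⟩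
  · obtain ⟨z, R, hz, hyz, hfix, hR⟩ := hmove (h y) (mem_range_self y) fun hc => hy ((hmem y).2 hc)
    obtain ⟨g, hg⟩ := hR.exists_equiv h
    refine ⟨g, fun v hv => (hg v v).1 (hfix _ ((hmem v).1 hv)), fun hgy => ?_⟩
    obtain ⟨b, rfl⟩ := (hR.subset hyz).2
    exact hz (congrArg h (((hg y b).1 hyz).symm.trans hgy))

/-- Every self-embedding of a nonempty countable saturated structure with quantifier elimination
can be composed with another one so that both the composite and the second factor have
superhomogeneous range. -/
theorem exists_superhomogeneous_factorization [Countable L.Symbols] {A : Type w} [L.Structure A]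
    [Nonempty A] [Countable A] (hA : IsSaturated L A) (hQE : HasQE L A) (ι : A ↪[L] A) :
    ∃ α β : A ↪[L] A, ⇑α = ⇑β ∘ ⇑ι ∧
      IsSuperhomogeneous L A α.toHom.range ∧
      IsSuperhomogeneous L A β.toHom.range := by
  classical
  let C := (Filter.hyperfilter ℕ : Filter ℕ).Product fun _ : ℕ => A
  have hC : CountablySaturated L C := countablySaturated_ultrapower
  let d : A ↪ₑ[L] C := diagonalEmbedding L A
  let ιₑ : A ↪ₑ[L] A := ⟨ι, fun n φ x => hQE.realize_iff ι (Embedding.refl L A) φ x⟩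
  let e : Bool → (A ↪ₑ[L] C) := fun b => bif b then d else d.comp ιₑ
  have hed : ∀ b, range (e b) ⊆ range d := by
    rintro (_ | _)
    · exact range_comp_subset_range ι d
    · exact Subset.rfl
  have hfull : ∀ (b : Bool) (F : Set (C × C)), ∃ R, (PartialElementary L F ∧ F.Finite ∧
      F ⊆ range (e b) ×ˢ range (e b)) →
      F ⊆ R ∧ IsElementaryBijection L R (range (e b)) (range (e b)) := by
    intro b F
    by_cases h : PartialElementary L F ∧ F.Finite ∧ F ⊆ range (e b) ×ˢ range (e b)
    · obtain ⟨R, hR⟩ := exists_isElementaryBijection_range hC hA (e b) h.1 h.2.1 h.2.2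
      exact ⟨R, fun _ => hR⟩
    · exact ⟨∅, fun h' => absurd h' h⟩
  choose full hfull using hfull
  have hmv : ∀ (b : Bool) (y : C), ∃ z, y ∉ range (e b) → z ≠ y ∧
      PartialElementary L (insert (y, z) {p : C × C | p.1 ∈ range (e b) ∧ p.1 = p.2}) := by
    intro b y
    by_cases hy : y ∈ range (e b)
    · exact ⟨y, fun h => absurd hy h⟩
    · obtain ⟨z, hz⟩ := PartialElementary.exists_insert_diagonal_ne hC (e b) hy
      exact ⟨z, fun _ => hz⟩
  choose z hz using hmv
  let moved : Bool → Set (C × C) → Set (Set (C × C)) := fun b F =>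
    (fun p : C × C => insert (p.1, z b p.1) {p : C × C | p.1 ∈ range (e b) ∧ p.1 = p.2}) '' F
  obtain ⟨W, hdW, hWc, hW⟩ := exists_countable_closed hC (countable_range d)
    (fun F => if F.Countable then insert F (range fun b => full b F) ∪ ⋃ b, moved b F else ∅)
    (fun F => by
      split_ifs with hF
      · exact ((countable_range _).insert _).union (countable_iUnion fun b => hF.image _)
      · exact countable_empty)
  obtain ⟨R, -, hR⟩ := exists_isElementaryBijection (countable_range d) hWc
    (F := (∅ : Set (C × C))) (PartialElementary.of_eq (by simp)) finite_empty (empty_subset _)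
    (fun F hF hfin hsub x hx => by
      obtain ⟨R, hFR, hR⟩ := hW F hfin (hsub.trans (prod_mono hdW Subset.rfl)) F
        (by rw [if_pos hfin.countable]; exact Or.inl (mem_insert _ _)) hF hfin.countable
      obtain ⟨y, hy⟩ := hR.exists_right x (hdW hx)
      exact ⟨y, (hR.subset hy).2, hR.partialElementary.mono (insert_subset hy hFR)⟩)
    (fun F hF hfin hsub y _ => by
      obtain ⟨x, hx, h⟩ := hF.swap.exists_insert_of_isSaturated hC hA d
        (hfin.preimage Prod.swap_injective.injOn) (fun p hp => (hsub hp).1) y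
      exact ⟨x, hx, h.insert_of_swap⟩)
  obtain ⟨h, rfl⟩ := hR.exists_elementaryEmbedding d
  obtain ⟨β, hβ⟩ := exists_elementaryEmbedding_comp_eq h d hdW
  have main : ∀ (b : Bool) (α : A ↪[L] A), (∀ a, h (α a) = e b a) →
      IsSuperhomogeneous L A α.toHom.range := by
    intro b α hα
    have heW := (hed b).trans hdW
    refine isSuperhomogeneous_range hQE h (e b) α hα (fun F hF hfin hsub => ?_) fun y hy hyj => ?_
    · obtain ⟨hFR, hR₁⟩ := hfull b F ⟨hF, hfin, hsub⟩
      obtain ⟨R, hR₁R, hR⟩ := hW F hfin (hsub.trans (prod_mono heW heW)) (full b F)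
        (by rw [if_pos hfin.countable]; exact Or.inl (Or.inr (mem_range_self b)))
        hR₁.partialElementary
        (((countable_range _).prod (countable_range _)).mono hR₁.subset)
      exact ⟨_, R, hFR, hR₁R, hR₁, hR⟩
    · obtain ⟨hzy, hpe⟩ := hz b y hyj
      have hcount : {p : C × C | p.1 ∈ range (e b) ∧ p.1 = p.2}.Countable :=
        ((countable_range (e b)).prod (countable_range (e b))).mono (by
          rintro ⟨p, q⟩ ⟨hp, hpq⟩
          obtain rfl : p = q := hpq
          exact ⟨hp, hp⟩)
      obtain ⟨R, hsub, hR⟩ := hW {(y, y)} (finite_singleton _)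
        (singleton_subset_iff.2 ⟨hy, hy⟩) _
        (by
          rw [if_pos (countable_singleton _)]
          exact Or.inr (mem_iUnion.2 ⟨b, mem_image_of_mem _ (mem_singleton _)⟩))
        hpe (hcount.insert _)
      exact ⟨_, R, hzy, hsub (mem_insert _ _), fun x hx => hsub (Or.inr ⟨hx, rfl⟩), hR⟩
  exact ⟨β.toEmbedding.comp ι, β.toEmbedding, rfl, main false _ fun a => hβ _, main true _ hβ⟩

end

/-- Let `A` be a smooth countable saturated structure. Then every
self-embedding `ι` of `A` factors as `α = β ∘ ι` where `α` and `β` are self-embeddings of `A`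
with superhomogeneous images. -/
theorem statement_19 (L : FirstOrder.Language.{u, v}) (A : Type w) [L.Structure A]
    (hsm : Smooth L A) (ι : A ↪[L] A) :
    ∃ α β : A ↪[L] A, ⇑α = ⇑β ∘ ⇑ι ∧
      IsSuperhomogeneous L A α.toHom.range ∧
      IsSuperhomogeneous L A β.toHom.range := by
  obtain ⟨hL, hA, hsat, hQE⟩ := hsm
  have : Countable L.Symbols := mk_le_aleph0_iff.1 hL
  rcases isEmpty_or_nonempty A with hE | hN
  · have hV : ∀ V : L.Substructure A, IsSuperhomogeneous L A V := fun V =>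
      ⟨fun S _ _ f _ => ⟨Language.Equiv.refl L A, fun s => hE.elim s.1, image_id _⟩,
        fun y => hE.elim y⟩
    exact ⟨ι, Embedding.refl L A, rfl, hV _, hV _⟩
  · exact exists_superhomogeneous_factorization hsat hQE ι

end Paper
end
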